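/- Let Δ be a (d-1)-dimensional simplicial complex and K a field. Then reg(K[Δ^{⟨r⟩}]) = d-1 if H̃_{d-1}(Δ;K) = 0 and r ≥ d, and reg(K[Δ^{⟨r⟩}]) = d if H̃_{d-1}(Δ;K) ≠ 0 (for every r ≥ 1). Moreover, for 1 ≤ r ≤ d-1 one has reg(K[Δ^{⟨r⟩}]) ≥ max(reg(K[Δ]), r-1). -/

import Mathlib

open Finset BigOperators

noncomputable section
open scoped Classical

/-- A finite abstract simplicial complex on (a finite subset of) `ℕ`,
given as its finite set of faces. -/
abbrev SC := Finset (Finset ℕ)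

/-- `Δ` is a simplicial complex: it is closed under taking subsets of faces. -/
def IsComplex {α : Type*} [DecidableEq α] (Δ : Finset (Finset α)) : Prop :=
  ∀ s ∈ Δ, ∀ t ⊆ s, t ∈ Δ

/-- The vertex set (ground set) of a complex: the union of all of its faces. -/
def vertexSet {α : Type*} [DecidableEq α] (Δ : Finset (Finset α)) : Finset α :=
  Δ.sup id

/-- The number of vertices of a complex. -/
def nverts {α : Type*} [DecidableEq α] (Δ : Finset (Finset α)) : ℕ :=
  (vertexSet Δ).card

/-- The full `(d-1)`-simplex `Δ_{d-1}`: all subsets of a `d`-element vertex set. -/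
def simplexC (d : ℕ) : SC := (Finset.range d).powerset

/-- The boundary complex of the simplex on `k` vertices (a `(k-2)`-sphere):
all proper subsets of a `k`-element vertex set. -/
def boundaryC (k : ℕ) : SC := ((Finset.range k).powerset).erase (Finset.range k)

/-- Encoding of finite subsets of `ℕ` as natural numbers (injective). -/
def enc : Finset ℕ → ℕ := Encodable.encode

/-- `C` is a chain of sets under inclusion. -/
def IsChainF (C : Finset (Finset ℕ)) : Prop := ∀ s ∈ C, ∀ t ∈ C, s ⊆ t ∨ t ⊆ s

/-- The barycentric subdivision `sd(Δ)`: its vertices are (encodings of) the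
nonempty faces of `Δ`, and its faces are the chains of nonempty faces of `Δ`. -/
def sd (Δ : SC) : SC :=
  ((Δ.erase ∅).powerset.filter IsChainF).image (fun C => C.image enc)

/-- The induced subcomplex `Δ_W` on a vertex subset `W`. -/
def inducedSC {α : Type*} [DecidableEq α] (Δ : Finset (Finset α)) (W : Finset α) :
    Finset (Finset α) := Δ.filter (fun s => s ⊆ W)

/-- `fvec Δ k` is the number of faces of `Δ` of cardinality `k`
(i.e. of dimension `k-1`); so `f_{i}^Δ = fvec Δ (i+1)`. -/
def fvec (Δ : SC) (k : ℕ) : ℕ := (Δ.filter (fun s => s.card = k)).card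

/-- A minimal non-face of a complex. -/
def IsMinNonFace {α : Type*} [DecidableEq α] (Δ : Finset (Finset α)) (N : Finset α) : Prop :=
  N ⊆ vertexSet Δ ∧ N ∉ Δ ∧ ∀ M ⊂ N, M ∈ Δ

/-- `t_1(K[Δ])`: the largest cardinality of a minimal non-face of `Δ`, equivalently the
largest degree of a minimal generator of the Stanley-Reisner ideal `I_Δ`. -/
def t1 {α : Type*} [DecidableEq α] (Δ : Finset (Finset α)) : ℕ :=
  ((vertexSet Δ).powerset.filter (fun N => IsMinNonFace Δ N)).sup Finset.card

/-- A complex is flag if all its minimal non-faces have cardinality `2`. -/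
def IsFlag {α : Type*} [DecidableEq α] (Δ : Finset (Finset α)) : Prop :=
  ∀ N : Finset α, IsMinNonFace Δ N → N.card = 2

/-- A complex is a full simplex if it consists of all subsets of its vertex set. -/
def IsFullSimplex {α : Type*} [DecidableEq α] (Δ : Finset (Finset α)) : Prop :=
  Δ = (vertexSet Δ).powerset

/-- Abstract isomorphism of simplicial complexes (possibly on different ground sets):
there is a map of vertices, injective on the vertex set, carrying the faces of the first
complex exactly onto the faces of the second. -/
def ComplexIso {α β : Type*} [DecidableEq α] [DecidableEq β]
    (Δ : Finset (Finset α)) (Γ : Finset (Finset β)) : Prop :=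
  ∃ φ : α → β, Set.InjOn φ ↑(vertexSet Δ) ∧ Γ = Δ.image (fun s => s.image φ)

variable (K : Type*) [Field K]

/-- The boundary of (the indicator chain of) a single face, with the usual signs coming
from the ordering of the vertices. -/
def bdryFace (s : Finset ℕ) : Finset ℕ →₀ K :=
  ∑ v ∈ s, ((-1 : K) ^ ((s.filter (fun w => w < v)).card)) • Finsupp.single (s.erase v) (1 : K)

/-- The simplicial boundary operator on the (augmented/reduced) chain space. -/
def bdry : (Finset ℕ →₀ K) →ₗ[K] (Finset ℕ →₀ K) :=
  Finsupp.lsum K fun s => LinearMap.toSpanSingleton K (Finset ℕ →₀ K) (bdryFace K s)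

/-- The span of the faces of `Δ` of cardinality `n` (empty for `n < 0`):
the space of `(n-1)`-dimensional reduced chains of `Δ`. -/
def facesSpan (Δ : SC) (n : ℤ) : Submodule K (Finset ℕ →₀ K) :=
  Submodule.span K ((fun s => Finsupp.single s (1 : K)) '' {s | s ∈ Δ ∧ (s.card : ℤ) = n})

/-- Reduced `(n-1)`-cycles of `Δ`. -/
def cyclesOn (Δ : SC) (n : ℤ) : Submodule K (Finset ℕ →₀ K) :=
  facesSpan K Δ n ⊓ LinearMap.ker (bdry K)

/-- Reduced `(n-1)`-boundaries of `Δ`. -/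
def boundariesOn (Δ : SC) (n : ℤ) : Submodule K (Finset ℕ →₀ K) :=
  Submodule.map (bdry K) (facesSpan K Δ (n + 1))

/-- `redHdim K Δ n = dim_K H̃_{n-1}(Δ; K)`, the dimension of reduced simplicial homology
of `Δ` in the degree whose chains are the faces of cardinality `n`. -/
def redHdim (Δ : SC) (n : ℤ) : ℕ :=
  Module.finrank K ↥(cyclesOn K Δ n) -
    Module.finrank K ↥(boundariesOn K Δ n ⊓ cyclesOn K Δ n)

/-- The graded Betti number `β_{i,j}(K[Δ]) = dim_K Tor_i^S(K[Δ], K)_j` of the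
Stanley-Reisner ring of `Δ`, expressed (via Hochster's formula) through reduced homology of
induced subcomplexes: `β_{i,j} = Σ_{W ⊆ Ω, #W = j} dim_K H̃_{j-i-1}(Δ_W; K)`. -/
def bettiSR (Δ : SC) (i j : ℕ) : ℕ :=
  ∑ W ∈ (vertexSet Δ).powerset.filter (fun W => W.card = j),
    redHdim K (inducedSC Δ W) ((j : ℤ) - i)

/-- The projective dimension of `K[Δ]` over the polynomial ring: the largest homological
degree with a nonzero Betti number. -/
def pdimSR (Δ : SC) : ℕ :=
  ((Finset.range (nverts Δ + 1)).filter
    (fun i => ∃ j ∈ Finset.range (2 * nverts Δ + 1), bettiSR K Δ i j ≠ 0)).sup id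

/-- The depth of `K[Δ]` (via the Auslander–Buchsbaum formula). -/
def depthSR (Δ : SC) : ℕ := nverts Δ - pdimSR K Δ

/-- The Castelnuovo–Mumford regularity of `K[Δ]`:
the largest `j - i` with `β_{i,j}(K[Δ]) ≠ 0`. -/
def regSR (Δ : SC) : ℕ :=
  ((Finset.range (nverts Δ + 1) ×ˢ Finset.range (2 * nverts Δ + 1))).sup
    (fun p => if bettiSR K Δ p.1 p.2 ≠ 0 then p.2 - p.1 else 0)

/-- The number of homological degrees `i` with `β_{i,i+j}(K[Δ]) ≠ 0`. -/
def strandCount (Δ : SC) (j : ℕ) : ℕ :=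
  ((Finset.range (nverts Δ + 1)).filter (fun i => bettiSR K Δ i (i + j) ≠ 0)).card

/-- The numbers `m_j(d)`: `m_j(d) = j` if `j ≤ d/2`, and
`m_j(d) = 2^{a+2}(c+d-j) - 2d + j` if `j ≥ d/2`, where `2j-d = a(d-j)+c`, `0 ≤ c < d-j`. -/
def mj (d j : ℕ) : ℕ :=
  if 2 * j ≤ d then j
  else 2 ^ ((2 * j - d) / (d - j) + 2) * ((2 * j - d) % (d - j) + (d - j)) + j - 2 * d

/-- `N(d)`: the number of vertices of `sd^3(Δ_{d-1})` not lying on the boundary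
of `sd^3(Δ_{d-1})`. -/
def Nd (d : ℕ) : ℕ :=
  ((vertexSet (sd^[3] (simplexC d))) \ (vertexSet (sd^[3] (boundaryC d)))).card

/-- The induced subcomplex `σ̃` of `Δ` spanned by the support of a chain `σ`:
all faces of `Δ` contained in some face of the support of `σ`. -/
def cycleCplx (Δ : SC) (σ : Finset ℕ →₀ K) : SC :=
  Δ.filter (fun F => ∃ G ∈ σ.support, F ⊆ G)

/-- `σ` is a minimal homology `(d-1)`-cycle of the `(d-1)`-dimensional complex `Δ`:
a nonzero `(d-1)`-cycle such that no nonzero `(d-1)`-cycle `σ'` satisfies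
`f_i^{σ̃} > f_i^{σ̃'}` and `f_j^{σ̃} = f_j^{σ̃'}` for all `i < j ≤ d-1`, for some `i`. -/
def IsMinimalCycle (Δ : SC) (d : ℕ) (σ : Finset ℕ →₀ K) : Prop :=
  σ ≠ 0 ∧ σ ∈ cyclesOn K Δ (d : ℤ) ∧
    ∀ σ' : Finset ℕ →₀ K, σ' ≠ 0 → σ' ∈ cyclesOn K Δ (d : ℤ) →
      ¬ ∃ i ≤ d - 1, fvec (cycleCplx K Δ σ') (i + 1) < fvec (cycleCplx K Δ σ) (i + 1) ∧
          ∀ j, i < j → j ≤ d - 1 →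
            fvec (cycleCplx K Δ σ) (j + 1) = fvec (cycleCplx K Δ σ') (j + 1)

/-- The support of a lattice point, as a set of natural numbers. -/
def tupSupp {n : ℕ} (a : Fin n → ℕ) : Finset ℕ :=
  (Finset.univ.filter (fun l : Fin n => a l ≠ 0)).image Fin.val

/-- The `k`-th component of `𝔦(a) = Σ_l a_l u_l`, where `u_l = e_l + ⋯ + e_n`;
so `𝔦(a)_k = Σ_{l ≤ k} a_l`. -/
def iComp {n : ℕ} (a : Fin n → ℤ) (k : Fin n) : ℤ :=
  ∑ l ∈ Finset.univ.filter (fun l : Fin n => l ≤ k), a l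

/-- The compatibility condition on pairs of vertices in the edgewise subdivision:
`𝔦(a-b) ∈ {0,1}^n` or `𝔦(b-a) ∈ {0,1}^n`. -/
def edgeOK {n : ℕ} (a b : Fin n → ℕ) : Prop :=
  (∀ k, iComp (fun l => (a l : ℤ) - (b l : ℤ)) k ∈ ({0, 1} : Set ℤ)) ∨
  (∀ k, iComp (fun l => (b l : ℤ) - (a l : ℤ)) k ∈ ({0, 1} : Set ℤ))

/-- The `r`-th edgewise subdivision of a complex `Δ` on vertex set `[n]`, as a complex on
the ground set `Ω_{r,n}` of lattice points (tuples). -/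
def edgewiseT (n r : ℕ) (Δ : SC) : Finset (Finset (Fin n → ℕ)) :=
  (Finset.Nat.antidiagonalTuple n r).powerset.filter
    (fun F => F.sup tupSupp ∈ Δ ∧ ∀ a ∈ F, ∀ b ∈ F, edgeOK a b)

/-- Encoding of lattice points as natural numbers (injective). -/
def encTup {n : ℕ} (a : Fin n → ℕ) : ℕ := Encodable.encode (List.ofFn a)

/-- The `r`-th edgewise subdivision `Δ^{⟨r⟩}`, re-encoded as a complex on `ℕ`. -/
def edgewise (n r : ℕ) (Δ : SC) : SC :=
  (edgewiseT n r Δ).image (fun F => F.image encTup)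

end

noncomputable section
open scoped Classical

section alg
variable (K : Type*) [Field K]

def Ew (v : ℕ) : (Finset ℕ →₀ K) →ₗ[K] (Finset ℕ →₀ K) :=
  Finsupp.lsum K fun s => LinearMap.toSpanSingleton K (Finset ℕ →₀ K)
    (if v ∈ s then 0 else
      ((-1 : K) ^ ((s.filter (fun w => w < v)).card)) • Finsupp.single (insert v s) (1 : K))

lemma bdry_single (s : Finset ℕ) : bdry K (Finsupp.single s 1) = bdryFace K s := by
  simp [bdry]

lemma Ew_single (v : ℕ) (s : Finset ℕ) : Ew K v (Finsupp.single s 1) =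
    (if v ∈ s then 0 else
      ((-1 : K) ^ ((s.filter (fun w => w < v)).card)) • Finsupp.single (insert v s) (1 : K)) := by
  simp [Ew]

lemma Ew_mem {v : ℕ} {s : Finset ℕ} (h : v ∈ s) : Ew K v (Finsupp.single s 1) = 0 := by
  rw [Ew_single, if_pos h]

lemma Ew_not_mem {v : ℕ} {s : Finset ℕ} (h : v ∉ s) : Ew K v (Finsupp.single s 1) =
      ((-1 : K) ^ ((s.filter (fun w => w < v)).card)) • Finsupp.single (insert v s) (1 : K) := by
  rw [Ew_single, if_neg h]

lemma Ew_min {v : ℕ} {s : Finset ℕ} (h : ∀ w ∈ s, v < w) : Ew K v (Finsupp.single s 1) =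
      Finsupp.single (insert v s) (1 : K) := by
  rw [Ew_not_mem K (fun hv => lt_irrefl _ (h v hv))]
  rw [Finset.filter_false_of_mem (fun w hw => not_lt.2 (h w hw).le)]
  simp

lemma lin_ext {M : Type*} [AddCommGroup M] [Module K M] {f g : (Finset ℕ →₀ K) →ₗ[K] M}
    (h : ∀ s, f (Finsupp.single s 1) = g (Finsupp.single s 1)) : f = g := by
  apply Finsupp.lhom_ext'
  intro s
  apply LinearMap.ext_ring
  simpa using h s

lemma Ew_self (v : ℕ) (x : Finset ℕ →₀ K) : Ew K v (Ew K v x) = 0 := by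
  have : (Ew K v).comp (Ew K v) = 0 := by
    apply lin_ext
    intro s
    by_cases h : v ∈ s
    · simp [Ew_mem K h]
    · simp only [LinearMap.comp_apply, LinearMap.zero_apply, Ew_not_mem K h, map_smul, Ew_mem K (Finset.mem_insert_self v s), smul_zero]
  exact congrArg (fun f => f x) this

lemma card_filter_insert_lt {v w : ℕ} {s : Finset ℕ} (h : w ∉ s) :
    ((insert w s).filter (fun u => u < v)).card =
      (s.filter (fun u => u < v)).card + if w < v then 1 else 0 := by
  rw [Finset.filter_insert]
  split_ifs with h1
  · rw [Finset.card_insert_of_notMem (by simp [h])]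
  · simp

lemma Ew_anti (v w : ℕ) (x : Finset ℕ →₀ K) : Ew K v (Ew K w x) = - Ew K w (Ew K v x) := by
  by_cases hvw : v = w
  · subst hvw; simp [Ew_self]
  have : (Ew K v).comp (Ew K w) = - (Ew K w).comp (Ew K v) := by
    apply lin_ext
    intro s
    by_cases h : v ∈ s
    · by_cases h' : w ∈ s
      · simp [Ew_mem K h, Ew_mem K h']
      · simp only [LinearMap.comp_apply, LinearMap.neg_apply, Ew_mem K h, Ew_not_mem K h', map_smul, map_zero, neg_zero, Ew_mem K (Finset.mem_insert_of_mem h), smul_zero]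
    · by_cases h' : w ∈ s
      · simp only [LinearMap.comp_apply, LinearMap.neg_apply, Ew_not_mem K h, Ew_mem K h', map_smul, map_zero, neg_zero, Ew_mem K (Finset.mem_insert_of_mem h'), smul_zero]
      · have h1 : v ∉ insert w s := by simp [h, hvw]
        have h2 : w ∉ insert v s := by simp [h', Ne.symm hvw]
        simp only [LinearMap.comp_apply, LinearMap.neg_apply, Ew_not_mem K h, Ew_not_mem K h',
          map_smul, Ew_not_mem K h1, Ew_not_mem K h2, smul_smul,
          card_filter_insert_lt h, card_filter_insert_lt h', Finset.insert_comm v w s]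
        rw [← neg_smul]
        congr 1
        rcases lt_or_gt_of_ne hvw with h3 | h3
        · simp [h3, not_lt.2 h3.le]; ring
        · simp [h3, not_lt.2 h3.le]; ring
  exact congrArg (fun f => f x) this

lemma neg_one_sq_pow (k : ℕ) : (-1 : K) ^ k * (-1) ^ k = 1 := by
  rw [← mul_pow]; simp

lemma bdry_Ew (v : ℕ) (x : Finset ℕ →₀ K) : bdry K (Ew K v x) = x - Ew K v (bdry K x) := by
  have : (bdry K).comp (Ew K v) = LinearMap.id - (Ew K v).comp (bdry K) := by
    apply lin_ext
    intro s
    by_cases h : v ∈ s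
    · simp only [LinearMap.comp_apply, Ew_mem K h, map_zero, LinearMap.sub_apply, LinearMap.id_apply,
        bdry_single, bdryFace, map_sum, map_smul]
      rw [Finset.sum_eq_single_of_mem v h]
      · rw [Ew_not_mem K (Finset.notMem_erase v s), smul_smul, Finset.insert_erase h]
        have : (s.erase v).filter (fun w => w < v) = s.filter (fun w => w < v) := by
          ext u; simp only [Finset.mem_filter, Finset.mem_erase]; 
          constructor
          · rintro ⟨⟨_, a⟩, b⟩; exact ⟨a, b⟩
          · rintro ⟨a, b⟩; exact ⟨⟨b.ne, a⟩, b⟩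
        rw [this, neg_one_sq_pow]; simp
      · intro w hw hne
        rw [Ew_mem K (Finset.mem_erase.2 ⟨Ne.symm hne, h⟩), smul_zero]
    · simp only [LinearMap.comp_apply, Ew_not_mem K h, LinearMap.sub_apply, LinearMap.id_apply,
        bdry_single, bdryFace, map_sum, map_smul]
      rw [Finset.sum_insert h, smul_add, smul_smul, Finset.erase_insert h,
        Finset.filter_insert, if_neg (lt_irrefl v), neg_one_sq_pow, one_smul, sub_eq_add_neg]
      congr 1
      rw [Finset.smul_sum, ← Finset.sum_neg_distrib]
      apply Finset.sum_congr rfl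
      intro w hw
      have hvw : v ≠ w := fun e => h (e ▸ hw)
      rw [Ew_not_mem K (fun hh => h (Finset.mem_of_mem_erase hh)), smul_smul, smul_smul, ← neg_smul,
        Finset.erase_insert_of_ne hvw, card_filter_insert_lt h]
      congr 1
      have e : (s.filter (fun u => u < v)).card =
        ((s.erase w).filter (fun u => u < v)).card + if w < v then 1 else 0 := by
        conv_lhs => rw [← Finset.insert_erase hw]
        exact card_filter_insert_lt (Finset.notMem_erase _ _)
      rw [e]
      rcases lt_or_gt_of_ne hvw with h3 | h3
      · simp [h3, not_lt.2 h3.le]; ring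
      · simp [h3, not_lt.2 h3.le]; ring
  exact congrArg (fun f => f x) this

def wl (l : List ℕ) : Finset ℕ →₀ K := l.foldr (fun v x => Ew K v x) (Finsupp.single ∅ 1)

lemma wl_nil : wl K [] = Finsupp.single ∅ 1 := rfl
lemma wl_cons (v : ℕ) (l : List ℕ) : wl K (v :: l) = Ew K v (wl K l) := rfl

lemma bdry_empty : bdry K (Finsupp.single ∅ 1) = 0 := by
  rw [bdry_single]; simp [bdryFace]

lemma single_induct {p : (Finset ℕ →₀ K) → Prop} (h0 : p (Finsupp.single ∅ 1))
    (h1 : ∀ v s, (∀ w ∈ s, v < w) → p (Finsupp.single s 1) → p (Ew K v (Finsupp.single s 1)))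
    (s : Finset ℕ) : p (Finsupp.single s 1) := by
  induction s using Finset.induction_on_min with
  | empty => exact h0
  | insert v s hv ih =>
    have := h1 v s hv ih
    rwa [Ew_min K hv] at this

lemma bdry_bdry (x : Finset ℕ →₀ K) : bdry K (bdry K x) = 0 := by
  have : (bdry K).comp (bdry K) = 0 := by
    apply lin_ext
    intro s
    refine single_induct K (p := fun y => (bdry K ∘ₗ bdry K) y = (0 : _ →ₗ[K] _) y) ?_ ?_ s
    · simp [bdry_empty]
    · intro v s _ ih
      simp only [LinearMap.comp_apply, LinearMap.zero_apply] at ih ⊢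
      simp [bdry_Ew, ih]
  exact congrArg (fun f => f x) this

lemma wl_perm {l l' : List ℕ} (h : l.Perm l') :
    ∃ ε : K, ε ≠ 0 ∧ ∀ f : ℕ → ℕ, wl K (l.map f) = ε • wl K (l'.map f) := by
  induction h with
  | nil => exact ⟨1, one_ne_zero, fun f => by simp⟩
  | cons x _ ih =>
    obtain ⟨ε, h0, h⟩ := ih
    exact ⟨ε, h0, fun f => by simp [wl_cons, h f]⟩
  | swap x y l =>
    exact ⟨-1, by simp, fun f => by simp [wl_cons]; rw [Ew_anti]⟩
  | trans _ _ ih1 ih2 =>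
    obtain ⟨ε, h0, h⟩ := ih1
    obtain ⟨ε', h0', h'⟩ := ih2
    exact ⟨ε * ε', mul_ne_zero h0 h0', fun f => by rw [h f, h' f, smul_smul]⟩

lemma wl_nodup {l : List ℕ} (h : l.Nodup) :
    ∃ ε : K, ε ≠ 0 ∧ wl K l = ε • Finsupp.single l.toFinset 1 := by
  induction l with
  | nil => exact ⟨1, one_ne_zero, by simp [wl_nil]⟩
  | cons v l ih =>
    obtain ⟨ε, h0, e⟩ := ih (List.nodup_cons.1 h).2
    have hv : v ∉ l.toFinset := by simpa using (List.nodup_cons.1 h).1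
    refine ⟨ε * (-1) ^ ((l.toFinset.filter (fun w => w < v)).card), by simp [h0], ?_⟩
    rw [wl_cons, e, map_smul, Ew_not_mem K hv, smul_smul, List.toFinset_cons]

lemma wl_dup {l : List ℕ} (h : ¬ l.Nodup) : wl K l = 0 := by
  induction l with
  | nil => simp at h
  | cons v l ih =>
    by_cases hl : l.Nodup
    · have hv : v ∈ l := by
        by_contra hv; exact h (List.nodup_cons.2 ⟨hv, hl⟩)
      obtain ⟨ε, h0, e⟩ := wl_nodup K hl
      rw [wl_cons, e, map_smul, Ew_mem K (by simpa using hv), smul_zero]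
    · rw [wl_cons, ih hl, map_zero]

lemma wl_sort (s : Finset ℕ) : wl K (s.sort (· ≤ ·)) = Finsupp.single s 1 := by
  induction s using Finset.induction_on_min with
  | empty => simp [wl_nil]
  | insert v s hv ih =>
    rw [Finset.sort_insert (r := (· ≤ ·)) (fun b hb => (hv b hb).le) (fun h => lt_irrefl _ (hv v h)),
      wl_cons, ih, Ew_min K hv]

def push (f : ℕ → ℕ) : (Finset ℕ →₀ K) →ₗ[K] (Finset ℕ →₀ K) :=
  Finsupp.lsum K fun s => LinearMap.toSpanSingleton K (Finset ℕ →₀ K)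
    (wl K ((s.sort (· ≤ ·)).map f))

lemma push_single (f : ℕ → ℕ) (s : Finset ℕ) :
    push K f (Finsupp.single s 1) = wl K ((s.sort (· ≤ ·)).map f) := by
  simp [push]

lemma push_wl (f : ℕ → ℕ) (l : List ℕ) : push K f (wl K l) = wl K (l.map f) := by
  by_cases h : l.Nodup
  · have hp : l.Perm (l.toFinset.sort (· ≤ ·)) := by
      apply List.perm_of_nodup_nodup_toFinset_eq h (Finset.sort_nodup _ _)
      simp
    obtain ⟨ε, h0, e⟩ := wl_perm K hp
    have := e id
    simp only [List.map_id] at this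
    rw [this, map_smul, wl_sort, push_single, e f]
  · rw [wl_dup K h, wl_dup K, map_zero]
    exact fun h' => h (List.Nodup.of_map f h')

lemma push_Ew (f : ℕ → ℕ) (v : ℕ) (x : Finset ℕ →₀ K) :
    push K f (Ew K v x) = Ew K (f v) (push K f x) := by
  have : (push K f).comp (Ew K v) = (Ew K (f v)).comp (push K f) := by
    apply lin_ext
    intro s
    rw [← wl_sort]
    simp only [LinearMap.comp_apply, ← wl_cons, push_wl, List.map_cons]
  exact congrArg (fun f => f x) this

lemma push_empty (f : ℕ → ℕ) : push K f (Finsupp.single ∅ 1) = Finsupp.single ∅ 1 := by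
  rw [push_single]; simp [wl_nil]

lemma bdry_push (f : ℕ → ℕ) (x : Finset ℕ →₀ K) :
    bdry K (push K f x) = push K f (bdry K x) := by
  have : (bdry K).comp (push K f) = (push K f).comp (bdry K) := by
    apply lin_ext
    intro s
    refine single_induct K (p := fun y => (bdry K ∘ₗ push K f) y = (push K f ∘ₗ bdry K) y) ?_ ?_ s
    · simp [bdry_empty, push_empty]
    · intro v s _ ih
      simp only [LinearMap.comp_apply] at ih ⊢
      simp [bdry_Ew, ih, push_Ew]
  exact congrArg (fun f => f x) this

/-- push of a face is zero or a multiple of the image face. -/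
lemma push_face (f : ℕ → ℕ) (s : Finset ℕ) :
    (¬ Set.InjOn f s ∧ push K f (Finsupp.single s 1) = 0) ∨
    (Set.InjOn f s ∧ ∃ ε : K, push K f (Finsupp.single s 1) = ε • Finsupp.single (s.image f) 1) := by
  rw [push_single]
  by_cases h : ((s.sort (· ≤ ·)).map f).Nodup
  · right
    refine ⟨?_, ?_⟩
    · intro a ha b hb hab
      exact List.inj_on_of_nodup_map h (by simpa using ha) (by simpa using hb) hab
    obtain ⟨ε, _, e⟩ := wl_nodup K h
    refine ⟨ε, ?_⟩
    rw [e]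
    congr 2
    ext; simp
  · left
    refine ⟨fun hi => h ?_, wl_dup K h⟩
    apply List.Nodup.map_on _ (Finset.sort_nodup _ _)
    intro a ha b hb hab
    exact hi (by simpa using ha) (by simpa using hb) hab

end alg
end

noncomputable section
open scoped Classical

section homol
variable (K : Type*) [Field K]

lemma facesSpan_eq (Δ : SC) (m : ℤ) :
    facesSpan K Δ m = Finsupp.supported K K {s | s ∈ Δ ∧ (s.card : ℤ) = m} := by
  rw [Finsupp.supported_eq_span_single]; rfl

lemma mem_facesSpan {Δ : SC} {m : ℤ} {x : Finset ℕ →₀ K} :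
    x ∈ facesSpan K Δ m ↔ ∀ s ∈ x.support, s ∈ Δ ∧ (s.card : ℤ) = m := by
  rw [facesSpan_eq, Finsupp.mem_supported]; rfl

lemma supp_lin {A : Set (Finset ℕ)} {M : Type*} [AddCommGroup M] [Module K M]
    (f : (Finset ℕ →₀ K) →ₗ[K] M) (N : Submodule K M)
    (h : ∀ s ∈ A, f (Finsupp.single s 1) ∈ N) {x : Finset ℕ →₀ K}
    (hx : x ∈ Finsupp.supported K K A) : f x ∈ N := by
  rw [Finsupp.supported_eq_span_single] at hx
  have : Submodule.span K ((fun i => Finsupp.single i (1 : K)) '' A) ≤ N.comap f := by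
    rw [Submodule.span_le]
    rintro _ ⟨s, hs, rfl⟩
    exact h s hs
  exact this hx

lemma supp_eq {A : Set (Finset ℕ)} {M : Type*} [AddCommGroup M] [Module K M]
    (f g : (Finset ℕ →₀ K) →ₗ[K] M)
    (h : ∀ s ∈ A, f (Finsupp.single s 1) = g (Finsupp.single s 1)) {x : Finset ℕ →₀ K}
    (hx : x ∈ Finsupp.supported K K A) : f x = g x := by
  have := supp_lin K (f - g) ⊥ (fun s hs => by simp [h s hs]) hx
  simpa [sub_eq_zero] using this

lemma single_mem_supp {A : Set (Finset ℕ)} {s : Finset ℕ} (h : s ∈ A) :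
    (Finsupp.single s (1 : K)) ∈ Finsupp.supported K K A :=
  Finsupp.single_mem_supported K 1 h

lemma single_mem_facesSpan {Δ : SC} {m : ℤ} {s : Finset ℕ} (h : s ∈ Δ) (h' : (s.card : ℤ) = m) :
    (Finsupp.single s (1 : K)) ∈ facesSpan K Δ m := by
  rw [facesSpan_eq]; exact single_mem_supp K ⟨h, h'⟩

lemma facesSpan_mono {Δ Γ : SC} (h : Δ ⊆ Γ) (m : ℤ) : facesSpan K Δ m ≤ facesSpan K Γ m := by
  rw [facesSpan_eq, facesSpan_eq]
  exact Finsupp.supported_mono (fun s hs => ⟨h hs.1, hs.2⟩)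

lemma facesSpan_zero {Δ : SC} {m : ℤ} (h : ∀ s ∈ Δ, (s.card : ℤ) ≠ m) {x : Finset ℕ →₀ K}
    (hx : x ∈ facesSpan K Δ m) : x = 0 := by
  rw [mem_facesSpan] at hx
  by_contra h0
  obtain ⟨s, hs⟩ := Finsupp.support_nonempty_iff.2 h0
  exact h s (hx s hs).1 (hx s hs).2

lemma bdry_facesSpan {Δ : SC} (hC : IsComplex Δ) {m : ℤ} {x : Finset ℕ →₀ K}
    (hx : x ∈ facesSpan K Δ m) : bdry K x ∈ facesSpan K Δ (m - 1) := by
  rw [facesSpan_eq] at hx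
  refine supp_lin K (bdry K) _ ?_ hx
  rintro s ⟨hs, hm⟩
  rw [bdry_single, bdryFace]
  refine Submodule.sum_mem _ fun v hv => Submodule.smul_mem _ _ ?_
  apply single_mem_facesSpan K (hC s hs _ (Finset.erase_subset _ _))
  rw [← hm, Finset.card_erase_of_mem hv]
  have := Finset.card_pos.2 ⟨v, hv⟩
  omega

lemma facesSpan_finite (Δ : SC) (m : ℤ) : FiniteDimensional K (facesSpan K Δ m) := by
  apply FiniteDimensional.span_of_finite
  apply Set.Finite.image
  exact (Δ.finite_toSet).subset (fun s hs => hs.1)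

lemma redHdim_ne_zero {Δ : SC} {m : ℤ} : redHdim K Δ m ≠ 0 ↔
    ∃ z ∈ facesSpan K Δ m, bdry K z = 0 ∧ ¬ ∃ y ∈ facesSpan K Δ (m + 1), bdry K y = z := by
  have : FiniteDimensional K (facesSpan K Δ m) := facesSpan_finite K Δ m
  have : FiniteDimensional K (cyclesOn K Δ m) :=
    Submodule.finiteDimensional_of_le (inf_le_left : cyclesOn K Δ m ≤ facesSpan K Δ m)
  constructor
  · intro h
    by_contra! hc
    apply h
    have : cyclesOn K Δ m ≤ boundariesOn K Δ m := by
      rintro z ⟨hz, hz'⟩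
      exact hc z hz hz'
    rw [redHdim, inf_eq_right.2 this, Nat.sub_self]
  · rintro ⟨z, hz, hz', hn⟩
    have : boundariesOn K Δ m ⊓ cyclesOn K Δ m < cyclesOn K Δ m := by
      refine lt_of_le_of_ne inf_le_right fun e => hn ?_
      have : z ∈ boundariesOn K Δ m ⊓ cyclesOn K Δ m := by
        rw [e]; exact ⟨hz, hz'⟩
      exact this.1
    have := Submodule.finrank_lt_finrank_of_lt this
    rw [redHdim]; omega

lemma vertex_mem {Δ : SC} {s : Finset ℕ} (hs : s ∈ Δ) : s ⊆ vertexSet Δ := 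
  Finset.le_sup (f := id) hs

lemma regSR_le {Δ : SC} {D : ℕ} (h : ∀ W ⊆ vertexSet Δ, ∀ m : ℕ,
    redHdim K (inducedSC Δ W) (m : ℤ) ≠ 0 → m ≤ D) : regSR K Δ ≤ D := by
  rw [regSR]
  apply Finset.sup_le
  rintro ⟨i, j⟩ _
  dsimp only
  split_ifs with hb
  · rw [bettiSR] at hb
    obtain ⟨W, hW, hne⟩ := Finset.exists_ne_zero_of_sum_ne_zero hb
    rw [Finset.mem_filter, Finset.mem_powerset] at hW
    rcases le_total i j with hij | hij
    · rw [← Nat.cast_sub hij] at hne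
      exact h W hW.1 _ hne
    · omega
  · exact Nat.zero_le _

lemma le_regSR {Δ : SC} {W : Finset ℕ} (hW : W ⊆ vertexSet Δ) {m : ℕ}
    (h : redHdim K (inducedSC Δ W) (m : ℤ) ≠ 0) : m ≤ regSR K Δ := by
  have hm : m ≤ W.card := by
    obtain ⟨z, hz, _, hn⟩ := (redHdim_ne_zero K).1 h
    have hz0 : z ≠ 0 := by
      rintro rfl
      exact hn ⟨0, Submodule.zero_mem _, by simp⟩
    obtain ⟨s, hs⟩ := Finsupp.support_nonempty_iff.2 hz0
    obtain ⟨h1, h2⟩ := (mem_facesSpan K).1 hz s hs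
    rw [inducedSC, Finset.mem_filter] at h1
    have := Finset.card_le_card h1.2
    omega
  have hWc : W.card ≤ nverts Δ := Finset.card_le_card hW
  have hb : bettiSR K Δ (W.card - m) W.card ≠ 0 := by
    rw [bettiSR]
    intro h0
    rw [Finset.sum_eq_zero_iff] at h0
    have := h0 W (by simp [hW])
    rw [Nat.cast_sub hm] at this
    apply h
    rw [← this]; congr 1; ring
  rw [regSR]
  have := Finset.le_sup (s := Finset.range (nverts Δ + 1) ×ˢ Finset.range (2 * nverts Δ + 1))
    (f := fun p => if bettiSR K Δ p.1 p.2 ≠ 0 then p.2 - p.1 else 0)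
    (b := (W.card - m, W.card)) (by simp; omega)
  refine le_trans ?_ this
  dsimp only
  rw [if_pos hb]; omega

lemma exists_of_lt_regSR {Δ : SC} (h : regSR K Δ ≠ 0) : ∃ W ⊆ vertexSet Δ,
    redHdim K (inducedSC Δ W) (regSR K Δ : ℤ) ≠ 0 := by
  by_contra! hc
  have : regSR K Δ ≤ regSR K Δ - 1 := by
    apply regSR_le
    intro W hW m hm
    have h1 := le_regSR K hW hm
    rcases h1.lt_or_eq with h2 | h2
    · omega
    · subst h2; exact absurd (hc W hW) hm
  omega

def Acyc (Γ : SC) : Prop := ∀ (m : ℤ) (z : Finset ℕ →₀ K), z ∈ facesSpan K Γ m → bdry K z = 0 →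
  ∃ y ∈ facesSpan K Γ (m + 1), bdry K y = z

lemma carrier (Γ : SC) (hΓ : IsComplex Γ) (Car : Finset ℕ → SC)
    (hmono : ∀ s t, t ⊆ s → Car t ⊆ Car s)
    (hac : ∀ s ∈ Γ, s.Nonempty → Acyc K (Car s))
    (T : (Finset ℕ →₀ K) →ₗ[K] (Finset ℕ →₀ K)) (η : K) (e : ℤ) (D0 : Finset ℕ →₀ K)
    (hT : ∀ s ∈ Γ, T (Finsupp.single s 1) ∈ facesSpan K (Car s) (s.card + e - 1))
    (hTb : ∀ s ∈ Γ, bdry K (T (Finsupp.single s 1)) + η • T (bdry K (Finsupp.single s 1)) = 0)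
    (hD0 : D0 ∈ facesSpan K (Car ∅) e) (hD0' : bdry K D0 = T (Finsupp.single ∅ 1)) :
    ∃ D : (Finset ℕ →₀ K) →ₗ[K] (Finset ℕ →₀ K), D (Finsupp.single ∅ 1) = D0 ∧
      ∀ s ∈ Γ, D (Finsupp.single s 1) ∈ facesSpan K (Car s) (s.card + e) ∧
        bdry K (D (Finsupp.single s 1)) =
          T (Finsupp.single s 1) + η • D (bdry K (Finsupp.single s 1)) := by
  have key : ∀ N : ℕ, ∃ D : (Finset ℕ →₀ K) →ₗ[K] (Finset ℕ →₀ K), D (Finsupp.single ∅ 1) = D0 ∧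
      ∀ s ∈ Γ, s.card ≤ N → D (Finsupp.single s 1) ∈ facesSpan K (Car s) (s.card + e) ∧
        bdry K (D (Finsupp.single s 1)) =
          T (Finsupp.single s 1) + η • D (bdry K (Finsupp.single s 1)) := by
    intro N
    induction N with
    | zero =>
      refine ⟨Finsupp.lsum K fun _ => LinearMap.toSpanSingleton K (Finset ℕ →₀ K) D0, by simp, ?_⟩
      intro s hs hc
      have : s = ∅ := Finset.card_eq_zero.1 (Nat.le_zero.1 hc)
      subst this
      simp [bdry_empty, hD0, hD0']
    | succ N ih =>
      obtain ⟨D, hd0, hD⟩ := ih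
      have fill : ∀ s : Finset ℕ, ∃ y, s ∈ Γ → s.card = N + 1 → 
          y ∈ facesSpan K (Car s) (s.card + e) ∧
          bdry K y = T (Finsupp.single s 1) + η • D (bdry K (Finsupp.single s 1)) := by
        intro s
        by_cases h : s ∈ Γ ∧ s.card = N + 1
        · obtain ⟨hs, hc⟩ := h
          have hne : s.Nonempty := Finset.card_pos.1 (by omega)
          have h1 : D (bdry K (Finsupp.single s 1)) ∈ facesSpan K (Car s) (s.card + e - 1) := by
            rw [bdry_single, bdryFace, map_sum]
            refine Submodule.sum_mem _ fun v hv => ?_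
            rw [map_smul]
            refine Submodule.smul_mem _ _ ?_
            have hce := Finset.card_erase_of_mem hv
            have := (hD (s.erase v) (hΓ s hs _ (Finset.erase_subset _ _)) (by omega)).1
            have e1 : ((s.erase v).card : ℤ) + e = s.card + e - 1 := by omega
            rw [e1] at this
            exact facesSpan_mono K (hmono _ _ (Finset.erase_subset _ _)) _ this
          have h2 : bdry K (D (bdry K (Finsupp.single s 1))) = T (bdry K (Finsupp.single s 1)) := by
            have : bdry K (D (bdry K (Finsupp.single s 1))) = T (bdry K (Finsupp.single s 1))
                + η • D (bdry K (bdry K (Finsupp.single s 1))) := by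
              have hb : bdry K (Finsupp.single s 1) ∈
                  Finsupp.supported K K {t | t ∈ Γ ∧ (t.card : ℤ) = N} := by
                rw [← facesSpan_eq]
                have := bdry_facesSpan K hΓ (single_mem_facesSpan K hs rfl)
                have e1 : (N : ℤ) = s.card - 1 := by omega
                rw [e1]; exact this
              exact supp_eq K ((bdry K).comp D) (T + η • (D.comp (bdry K)))
                (fun t ht => (hD t ht.1 (by have := ht.2; omega)).2) hb
            rw [this, bdry_bdry, map_zero, smul_zero, add_zero]
          obtain ⟨y, hy, hy'⟩ := hac s hs hne _ (T (Finsupp.single s 1) + η • D (bdry K (Finsupp.single s 1)))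
            (Submodule.add_mem _ (hT s hs) (Submodule.smul_mem _ _ h1))
            (by rw [map_add, map_smul, h2]; exact hTb s hs)
          exact ⟨y, fun _ _ => ⟨by rwa [sub_add_cancel] at hy, hy'⟩⟩
        · exact ⟨0, fun h1 h2 => absurd ⟨h1, h2⟩ h⟩
      choose Y hY using fill
      let D' : (Finset ℕ →₀ K) →ₗ[K] (Finset ℕ →₀ K) :=
        Finsupp.lsum K fun s => LinearMap.toSpanSingleton K (Finset ℕ →₀ K)
          (if s.card = N + 1 then Y s else D (Finsupp.single s 1))
      have hD's : ∀ s, D' (Finsupp.single s 1) =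
          if s.card = N + 1 then Y s else D (Finsupp.single s 1) := by
        intro s; simp [D']
      have hD'b : ∀ s, s.card ≤ N + 1 → D' (bdry K (Finsupp.single s 1)) =
          D (bdry K (Finsupp.single s 1)) := by
        intro s hc
        rw [bdry_single, bdryFace, map_sum, map_sum]
        refine Finset.sum_congr rfl fun v hv => ?_
        rw [map_smul, map_smul, hD's, if_neg]
        rw [Finset.card_erase_of_mem hv]
        have := Finset.card_pos.2 ⟨v, hv⟩
        omega
      refine ⟨D', ?_, ?_⟩
      · rw [hD's, if_neg (by simp), hd0]
      · intro s hs hc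
        rw [hD'b s hc, hD's]
        split_ifs with h
        · exact hY s hs h
        · exact hD s hs (by omega)
  obtain ⟨D, h0, hD⟩ := key (Γ.sup Finset.card)
  exact ⟨D, h0, fun s hs => hD s hs (Finset.le_sup (f := Finset.card) hs)⟩

end homol
end

noncomputable section
open scoped Classical

def PS {n : ℕ} (a : Fin n → ℕ) (k : ℕ) : ℕ :=
  ∑ l ∈ Finset.range k, if h : l < n then a ⟨l, h⟩ else 0

lemma PS_zero {n : ℕ} (a : Fin n → ℕ) : PS a 0 = 0 := by simp [PS]

lemma PS_succ {n : ℕ} (a : Fin n → ℕ) (k : ℕ) :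
    PS a (k + 1) = PS a k + if h : k < n then a ⟨k, h⟩ else 0 := by
  rw [PS, Finset.sum_range_succ, PS]

lemma PS_mono {n : ℕ} (a : Fin n → ℕ) : Monotone (PS a) :=
  monotone_nat_of_le_succ fun k => by rw [PS_succ]; omega

lemma PS_n {n : ℕ} (a : Fin n → ℕ) : PS a n = ∑ l, a l := by
  rw [PS, Finset.sum_range]
  exact Finset.sum_congr rfl fun l _ => by simp

lemma PS_ge {n : ℕ} (a : Fin n → ℕ) {k : ℕ} (h : n ≤ k) : PS a k = ∑ l, a l := by
  induction k, h using Nat.le_induction with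
  | base => exact PS_n a
  | succ k hk ih => rw [PS_succ, ih, dif_neg (by omega), add_zero]

lemma PS_inj {n : ℕ} {a b : Fin n → ℕ} (h : ∀ k, PS a k = PS b k) : a = b := by
  funext l
  have h1 := PS_succ a l
  have h2 := PS_succ b l
  rw [dif_pos l.2] at h1 h2
  have := h l
  have := h (l + 1)
  simp only [Fin.eta] at h1 h2
  omega

lemma iComp_eq {n : ℕ} (f : Fin n → ℤ) (k : Fin n) :
    iComp f k = ∑ l ∈ Finset.range (k + 1), if h : l < n then f ⟨l, h⟩ else 0 := by
  rw [iComp, Finset.sum_filter]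
  have : ∀ l : Fin n, (if l ≤ k then f l else 0) =
      (fun i : ℕ => if i ≤ (k : ℕ) then (if h : i < n then f ⟨i, h⟩ else 0) else 0) l := by
    intro l; simp only [Fin.le_def, Fin.is_lt, dif_pos, Fin.eta]
  rw [Finset.sum_congr rfl (fun l _ => this l), Fin.sum_univ_eq_sum_range
    (fun i : ℕ => if i ≤ (k : ℕ) then (if h : i < n then f ⟨i, h⟩ else 0) else 0) n, ← Finset.sum_filter]
  apply Finset.sum_congr _ (fun _ _ => rfl)
  ext i; simp only [Finset.mem_filter, Finset.mem_range]
  have := k.2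
  omega

lemma iComp_sub {n : ℕ} (a b : Fin n → ℕ) (k : Fin n) :
    iComp (fun l => (a l : ℤ) - (b l : ℤ)) k = (PS a (k + 1) : ℤ) - PS b (k + 1) := by
  rw [iComp_eq, PS, PS]
  push_cast
  rw [← Finset.sum_sub_distrib]
  refine Finset.sum_congr rfl fun l _ => ?_
  split_ifs <;> simp

lemma iComp_iff {n r : ℕ} {a b : Fin n → ℕ} (ha : ∑ l, a l = r) (hb : ∑ l, b l = r) :
    (∀ k, iComp (fun l => (a l : ℤ) - (b l : ℤ)) k ∈ ({0, 1} : Set ℤ)) ↔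
      ∀ k, PS b k ≤ PS a k ∧ PS a k ≤ PS b k + 1 := by
  simp only [iComp_sub, Set.mem_insert_iff, Set.mem_singleton_iff]
  constructor
  · intro h k
    rcases k with _ | k
    · simp [PS_zero]
    · by_cases hk : k < n
      · have := h ⟨k, hk⟩
        simp only at this
        omega
      · rw [PS_ge a (by omega), PS_ge b (by omega)]; omega
  · intro h k
    have := h (k + 1)
    omega

lemma encTup_inj {n : ℕ} : Function.Injective (encTup (n := n)) := by
  intro a b h
  exact List.ofFn_injective (Encodable.encode_injective h)

def decV (n : ℕ) (v : ℕ) : Fin n → ℕ := Function.invFun (encTup (n := n)) v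

lemma decV_enc {n : ℕ} (a : Fin n → ℕ) : decV n (encTup a) = a :=
  Function.leftInverse_invFun encTup_inj a

def PV (n v k : ℕ) : ℕ := PS (decV n v) k
def Good (n r v : ℕ) : Prop := ∃ a ∈ Finset.Nat.antidiagonalTuple n r, encTup a = v
def spv (n v : ℕ) : Finset ℕ := tupSupp (decV n v)
def le1 (n w v : ℕ) : Prop := ∀ k, PV n w k ≤ PV n v k ∧ PV n v k ≤ PV n w k + 1

lemma PV_zero (n v : ℕ) : PV n v 0 = 0 := PS_zero _
lemma PV_mono (n v : ℕ) : Monotone (PV n v) := PS_mono _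

lemma Good.sum {n r v : ℕ} (h : Good n r v) : ∑ l, decV n v l = r := by
  obtain ⟨a, ha, rfl⟩ := h
  rw [decV_enc]; exact Finset.Nat.mem_antidiagonalTuple.1 ha

lemma Good.enc {n r v : ℕ} (h : Good n r v) : encTup (decV n v) = v := by
  obtain ⟨a, ha, rfl⟩ := h
  rw [decV_enc]

lemma Good.PV_ge {n r v k : ℕ} (h : Good n r v) (hk : n ≤ k) : PV n v k = r := by
  rw [PV, PS_ge _ hk, h.sum]

lemma Good.PV_le {n r v : ℕ} (h : Good n r v) (k : ℕ) : PV n v k ≤ r := by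
  rcases le_total n k with hk | hk
  · rw [h.PV_ge hk]
  · rw [← h.PV_ge le_rfl]; exact PV_mono n v hk

lemma Good.inj {n r v w : ℕ} (hv : Good n r v) (hw : Good n r w)
    (h : ∀ k, PV n v k = PV n w k) : v = w := by
  rw [← hv.enc, ← hw.enc, PS_inj h]

lemma mem_spv {n v l : ℕ} : l ∈ spv n v ↔ PV n v l < PV n v (l + 1) := by
  rw [PV, PV, PS_succ, spv, tupSupp]
  simp only [Finset.mem_image, Finset.mem_filter, Finset.mem_univ, true_and]
  constructor
  · rintro ⟨i, hi, rfl⟩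
    rw [dif_pos i.2]; simp only [Fin.eta]; omega
  · intro h
    by_cases hl : l < n
    · rw [dif_pos hl] at h
      exact ⟨⟨l, hl⟩, by omega, rfl⟩
    · rw [dif_neg hl] at h; omega

lemma realize {n r : ℕ} (Y : ℕ → ℕ) (h0 : Y 0 = 0) (hm : Monotone Y) (hr : ∀ k, n ≤ k → Y k = r) :
    ∃ v, Good n r v ∧ ∀ k, PV n v k = Y k := by
  let a : Fin n → ℕ := fun l => Y (l + 1) - Y l
  have ha : ∀ k, PS a k = Y k := by
    intro k
    induction k with
    | zero => rw [PS_zero, h0]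
    | succ k ih =>
      rw [PS_succ, ih]
      have := hm (Nat.le_succ k)
      split_ifs with h
      · simp only [a, Nat.succ_eq_add_one] at *; omega
      · rw [hr k (by omega), hr (k+1) (by omega)]; simp
  refine ⟨encTup a, ⟨a, ?_, rfl⟩, ?_⟩
  · rw [Finset.Nat.mem_antidiagonalTuple, ← PS_n, ha, hr n le_rfl]
  · intro k; rw [PV, decV_enc, ha]

lemma edgeOK_iff {n r v w : ℕ} (hv : Good n r v) (hw : Good n r w) :
    edgeOK (decV n v) (decV n w) ↔ le1 n w v ∨ le1 n v w := by
  rw [edgeOK, iComp_iff hv.sum hw.sum, iComp_iff hw.sum hv.sum]; rfl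

lemma mem_edgewise {n r : ℕ} {Γ : SC} {s : Finset ℕ} : s ∈ edgewise n r Γ ↔
    (∀ v ∈ s, Good n r v) ∧ s.biUnion (spv n) ∈ Γ ∧ ∀ v ∈ s, ∀ w ∈ s, le1 n w v ∨ le1 n v w := by
  rw [edgewise, Finset.mem_image]
  constructor
  · rintro ⟨F, hF, rfl⟩
    rw [edgewiseT, Finset.mem_filter, Finset.mem_powerset] at hF
    obtain ⟨h1, h2, h3⟩ := hF
    have hg : ∀ v ∈ F.image encTup, Good n r v := by
      intro v hv
      obtain ⟨a, ha, rfl⟩ := Finset.mem_image.1 hv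
      exact ⟨a, h1 ha, rfl⟩
    refine ⟨hg, ?_, ?_⟩
    · convert h2 using 1
      rw [Finset.image_biUnion, Finset.sup_eq_biUnion]
      refine Finset.biUnion_congr rfl fun a _ => ?_
      rw [spv, decV_enc]
    · intro v hv w hw
      rw [← edgeOK_iff (hg v hv) (hg w hw)]
      obtain ⟨a, ha, rfl⟩ := Finset.mem_image.1 hv
      obtain ⟨b, hb, rfl⟩ := Finset.mem_image.1 hw
      rw [decV_enc, decV_enc]
      exact h3 a ha b hb
  · rintro ⟨h1, h2, h3⟩
    refine ⟨s.image (decV n), ?_, ?_⟩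
    · rw [edgewiseT, Finset.mem_filter, Finset.mem_powerset]
      refine ⟨?_, ?_, ?_⟩
      · intro a ha
        obtain ⟨v, hv, rfl⟩ := Finset.mem_image.1 ha
        rw [Finset.Nat.mem_antidiagonalTuple]; exact (h1 v hv).sum
      · rw [Finset.sup_eq_biUnion, Finset.image_biUnion]; exact h2
      · intro a ha b hb
        obtain ⟨v, hv, rfl⟩ := Finset.mem_image.1 ha
        obtain ⟨w, hw, rfl⟩ := Finset.mem_image.1 hb
        rw [edgeOK_iff (h1 v hv) (h1 w hw)]
        exact h3 v hv w hw
    · rw [Finset.image_image]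
      conv_rhs => rw [← Finset.image_id (s := s)]
      exact Finset.image_congr fun v hv => (h1 v hv).enc

lemma edgewise_complex {n r : ℕ} {Γ : SC} (h : IsComplex Γ) : IsComplex (edgewise n r Γ) := by
  intro s hs t ht
  rw [mem_edgewise] at hs ⊢
  exact ⟨fun v hv => hs.1 v (ht hv), h _ hs.2.1 _ (Finset.biUnion_subset_biUnion_of_subset_left _ ht),
    fun v hv w hw => hs.2.2 v (ht hv) w (ht hw)⟩

lemma edgewise_mono {n r : ℕ} {Γ Γ' : SC} (h : Γ ⊆ Γ') : edgewise n r Γ ⊆ edgewise n r Γ' := by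
  intro s hs
  rw [mem_edgewise] at hs ⊢
  exact ⟨hs.1, h hs.2.1, hs.2.2⟩

lemma powerset_complex (F : Finset ℕ) : IsComplex F.powerset := by
  intro s hs t ht
  rw [Finset.mem_powerset] at *
  exact ht.trans hs

lemma le1_refl (n v : ℕ) : le1 n v v := fun _ => ⟨le_rfl, Nat.le_succ _⟩

/-- partial sums are constant off the support -/
lemma PV_const {n v a b : ℕ} (hab : a ≤ b) (h : ∀ l, a ≤ l → l < b → l ∉ spv n v) :
    PV n v a = PV n v b := by
  induction b, hab using Nat.le_induction with
  | base => rfl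
  | succ b hb ih =>
    rw [ih fun l h1 h2 => h l h1 (by omega)]
    have := h b hb (by omega)
    rw [mem_spv] at this
    have := PV_mono n v (Nat.le_succ b)
    simp only [Nat.succ_eq_add_one] at this
    omega

lemma Good.lt_of_spv {n v l : ℕ} (h : l ∈ spv n v) : l < n := by
  rw [spv, tupSupp, Finset.mem_image] at h
  obtain ⟨i, _, rfl⟩ := h
  exact i.2

lemma Good.PV_last {n r v k : ℕ} (h : Good n r v) (hk : ∀ l ∈ spv n v, l < k) : PV n v k = r := by
  rcases le_total n k with hn | hn
  · exact h.PV_ge hn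
  · rw [← h.PV_ge le_rfl]
    apply PV_const hn
    intro l h1 _ h3
    have := hk l h3; omega

lemma Good.spv_nonempty {n r v : ℕ} (hr : 1 ≤ r) (h : Good n r v) : (spv n v).Nonempty := by
  by_contra hc
  rw [Finset.not_nonempty_iff_eq_empty] at hc
  have := h.PV_last (k := 0) (by simp [hc])
  rw [PV_zero] at this; omega

/-- dimension bound -/
lemma card_le {n r : ℕ} (hr : 1 ≤ r) {Γ : SC} {s : Finset ℕ} (hs : s ∈ edgewise n r Γ) :
    s.card ≤ (s.biUnion (spv n)).card := by
  obtain ⟨hg, _, hp⟩ := mem_edgewise.1 hs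
  set F := s.biUnion (spv n) with hF
  rcases s.eq_empty_or_nonempty with rfl | hne
  · simp
  have hFne : F.Nonempty := by
    obtain ⟨v, hv⟩ := hne
    obtain ⟨l, hl⟩ := (hg v hv).spv_nonempty hr
    exact ⟨l, Finset.mem_biUnion.2 ⟨v, hv, hl⟩⟩
  have hsub : ∀ v ∈ s, ∀ l ∈ spv n v, l ∈ F := fun v hv l hl => Finset.mem_biUnion.2 ⟨v, hv, hl⟩
  let key : ℕ → ℕ := fun v => ∑ k ∈ F.erase (F.min' hFne), PV n v k
  -- injectivity
  have hle : ∀ v ∈ s, ∀ w ∈ s, le1 n w v → key w ≤ key v ∧ key v ≤ key w + (F.card - 1) := by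
    intro v hv w hw h
    refine ⟨Finset.sum_le_sum fun k _ => (h k).1, ?_⟩
    calc key v ≤ ∑ k ∈ F.erase (F.min' hFne), (PV n w k + 1) := Finset.sum_le_sum fun k _ => (h k).2
      _ = key w + (F.card - 1) := by
        rw [Finset.sum_add_distrib, Finset.sum_const, Finset.card_erase_of_mem (F.min'_mem hFne)]
        simp [key]
  have hF0 : ∀ v ∈ s, ∀ w ∈ s, (∀ k ∈ F.erase (F.min' hFne), PV n v k = PV n w k) → v = w := by
    intro v hv w hw h
    apply (hg v hv).inj (hg w hw)
    intro k
    -- next element of F at or above k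
    by_cases hk : ∃ l ∈ F, k ≤ l
    · have hex : (F.filter (fun l => k ≤ l)).Nonempty := by
        obtain ⟨l, h1, h2⟩ := hk
        exact ⟨l, Finset.mem_filter.2 ⟨h1, h2⟩⟩
      set m := (F.filter (fun l => k ≤ l)).min' hex with hm
      have hmm := Finset.min'_mem _ hex
      rw [← hm, Finset.mem_filter] at hmm
      have hc : ∀ u ∈ s, PV n u k = PV n u m := by
        intro u hu
        apply PV_const hmm.2
        intro l h1 h2 h3
        have := Finset.min'_le (F.filter (fun l => k ≤ l)) l (Finset.mem_filter.2 ⟨hsub u hu l h3, h1⟩)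
        omega
      rw [hc v hv, hc w hw]
      by_cases hmin : m = F.min' hFne
      · have hz : ∀ u ∈ s, PV n u m = 0 := by
          intro u hu
          rw [← PV_zero n u]
          symm
          apply PV_const (Nat.zero_le _)
          intro l _ h2 h3
          have := Finset.min'_le F l (hsub u hu l h3)
          omega
        rw [hz v hv, hz w hw]
      · exact h m (Finset.mem_erase.2 ⟨hmin, hmm.1⟩)
    · push Not at hk
      rw [(hg v hv).PV_last (fun l hl => hk l (hsub v hv l hl)),
        (hg w hw).PV_last (fun l hl => hk l (hsub w hw l hl))]
  have hinj' : ∀ v ∈ s, ∀ w ∈ s, le1 n w v → key v = key w → v = w := by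
    intro v hv w hw h he
    apply hF0 v hv w hw
    intro k hk
    have := (Finset.sum_eq_sum_iff_of_le (fun k _ => (h k).1)).1 he.symm
    exact (this k hk).symm
  have hinj : Set.InjOn key s := by
    intro v hv w hw he
    rcases hp v hv w hw with h | h
    · exact hinj' v hv w hw h he
    · exact (hinj' w hw v hv h he.symm).symm
  obtain ⟨v0, hv0, hmin⟩ := Finset.exists_min_image s key hne
  have himg : s.image key ⊆ Finset.Icc (key v0) (key v0 + (F.card - 1)) := by
    intro x hx
    obtain ⟨v, hv, rfl⟩ := Finset.mem_image.1 hx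
    rw [Finset.mem_Icc]
    refine ⟨hmin v hv, ?_⟩
    rcases hp v hv v0 hv0 with h | h
    · exact (hle v hv v0 hv0 h).2
    · exact (hle v0 hv0 v hv h).1.trans (Nat.le_add_right _ _)
  have := Finset.card_le_card himg
  rw [Finset.card_image_of_injOn hinj, Nat.card_Icc] at this
  have := hFne.card_pos
  omega

end

noncomputable section
open scoped Classical

def Rlt (key : ℕ → ℕ) (v w : ℕ) : Prop := key v < key w ∨ (key v = key w ∧ v < w)
def Rle (key : ℕ → ℕ) (v w : ℕ) : Prop := key v < key w ∨ (key v = key w ∧ v ≤ w)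

instance (key : ℕ → ℕ) : IsTrans ℕ (Rle key) := ⟨by
  intro a b c h1 h2; simp only [Rle] at *; omega⟩
instance (key : ℕ → ℕ) : Std.Antisymm (Rle key) := ⟨by
  intro a b h1 h2; simp only [Rle] at *; omega⟩
instance (key : ℕ → ℕ) : Std.Total (Rle key) := ⟨by
  intro a b; simp only [Rle] at *; omega⟩

lemma Rlt_sort (key : ℕ → ℕ) (s : Finset ℕ) : (s.sort (Rle key)).Pairwise (Rlt key) := by
  have h1 := s.pairwise_sort (Rle key)
  have h2 : (s.sort (Rle key)).Pairwise (· ≠ ·) := s.sort_nodup (Rle key)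
  refine (h1.and h2).imp ?_
  intro a b h
  simp only [Rle, Rlt] at *; omega

lemma sort_of_Rlt (key : ℕ → ℕ) {l : List ℕ} (h : l.Pairwise (Rlt key)) :
    l.toFinset.sort (Rle key) = l := by
  have hn : l.Nodup := h.imp (by rintro a b h rfl; simp only [Rlt] at h; omega)
  apply (List.toFinset_sort (Rle key) hn).2
  exact h.imp (by intro a b h; simp only [Rlt, Rle] at *; omega)

section prism
variable (K : Type*) [Field K] (key : ℕ → ℕ) (g' g : ℕ → ℕ)

def Plist : List ℕ → (Finset ℕ →₀ K)
  | [] => 0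
  | v :: l => Ew K (g' v) (wl K ((v :: l).map g)) - Ew K (g' v) (Plist l)

lemma exists_eps (s : Finset ℕ) : ∃ ε : K, Finsupp.single s 1 = ε • wl K (s.sort (Rle key)) := by
  obtain ⟨ε, h0, h⟩ := wl_nodup K (s.sort_nodup (Rle key))
  refine ⟨ε⁻¹, ?_⟩
  rw [h, smul_smul, inv_mul_cancel₀ h0, one_smul, Finset.sort_toFinset]

def epsS (s : Finset ℕ) : K := (exists_eps K key s).choose
lemma epsS_spec (s : Finset ℕ) : Finsupp.single s 1 = epsS K key s • wl K (s.sort (Rle key)) :=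
  (exists_eps K key s).choose_spec

def Pr : (Finset ℕ →₀ K) →ₗ[K] (Finset ℕ →₀ K) :=
  Finsupp.lsum K fun s => LinearMap.toSpanSingleton K (Finset ℕ →₀ K)
    (epsS K key s • Plist K g' g (s.sort (Rle key)))

lemma Pr_single (s : Finset ℕ) : Pr K key g' g (Finsupp.single s 1) =
    epsS K key s • Plist K g' g (s.sort (Rle key)) := by
  simp [Pr]

lemma Pr_wl {l : List ℕ} (h : l.Pairwise (Rlt key)) :
    Pr K key g' g (wl K l) = Plist K g' g l := by
  have hn : l.Nodup := h.imp (by rintro a b h rfl; simp only [Rlt] at h; omega)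
  obtain ⟨ε, h0, e⟩ := wl_nodup K hn
  have h1 := epsS_spec K key l.toFinset
  have h2 := Pr_single K key g' g l.toFinset
  rw [sort_of_Rlt key h] at h1 h2
  have h3 : ε * epsS K key l.toFinset = 1 := by
    rw [e, smul_smul] at h1
    have := congrArg (fun f => f l.toFinset) h1
    simp at this
    rw [mul_comm]; exact this.symm
  rw [e, map_smul, h2, smul_smul, h3, one_smul]

lemma Pr_Ew {v : ℕ} {x : Finset ℕ →₀ K}
    (hx : x ∈ Finsupp.supported K K {t : Finset ℕ | ∀ w ∈ t, Rlt key v w}) :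
    Pr K key g' g (Ew K v x) =
      Ew K (g' v) (push K g (Ew K v x)) - Ew K (g' v) (Pr K key g' g x) := by
  refine supp_eq K ((Pr K key g' g).comp (Ew K v))
    ((Ew K (g' v)).comp ((push K g).comp (Ew K v)) - (Ew K (g' v)).comp (Pr K key g' g)) ?_ hx
  intro t ht
  have hp := Rlt_sort key t
  have hp' : (v :: t.sort (Rle key)).Pairwise (Rlt key) :=
    List.pairwise_cons.2 ⟨fun w hw => ht w (by simpa using hw), hp⟩
  rw [epsS_spec K key t]
  simp only [map_smul, LinearMap.comp_apply, LinearMap.sub_apply, ← wl_cons, push_wl,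
    Pr_wl K key g' g hp, Pr_wl K key g' g hp']
  rw [Plist]; rfl

lemma wl_supp (l : List ℕ) : wl K l ∈ Finsupp.supported K K {t : Finset ℕ | ∀ w ∈ t, w ∈ l} := by
  by_cases h : l.Nodup
  · obtain ⟨ε, _, e⟩ := wl_nodup K h
    rw [e]
    exact Submodule.smul_mem _ _ (single_mem_supp K (by simp))
  · rw [wl_dup K h]; exact Submodule.zero_mem _

lemma bdry_supp {A : Set (Finset ℕ)} (hA : ∀ s ∈ A, ∀ t ⊆ s, t ∈ A) {x : Finset ℕ →₀ K}
    (hx : x ∈ Finsupp.supported K K A) : bdry K x ∈ Finsupp.supported K K A := by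
  refine supp_lin K (bdry K) _ ?_ hx
  intro s hs
  rw [bdry_single, bdryFace]
  refine Submodule.sum_mem _ fun v hv => Submodule.smul_mem _ _ ?_
  exact single_mem_supp K (hA s hs _ (Finset.erase_subset _ _))

lemma bdry_Plist {l : List ℕ} (h : l.Pairwise (Rlt key)) :
    bdry K (Plist K g' g l) = push K g (wl K l) - push K g' (wl K l)
      - Pr K key g' g (bdry K (wl K l)) := by
  induction l with
  | nil => simp [Plist, wl_nil, push_empty, bdry_empty]
  | cons v l ih =>
    have ih := ih (List.pairwise_cons.1 h).2
    have hv := (List.pairwise_cons.1 h).1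
    have hb : bdry K (wl K l) ∈ Finsupp.supported K K {t : Finset ℕ | ∀ w ∈ t, Rlt key v w} := by
      refine bdry_supp K (A := {t : Finset ℕ | ∀ w ∈ t, Rlt key v w}) ?_ ?_
      · intro s hs t ht w hw
        exact hs w (ht hw)
      · refine Finsupp.supported_mono ?_ (wl_supp K l)
        intro t ht w hw
        exact hv w (ht w hw)
    rw [Plist, map_sub, bdry_Ew, bdry_Ew, ← push_wl, wl_cons, push_Ew, push_Ew, bdry_Ew, bdry_Ew,
      map_sub (Pr K key g' g), Pr_Ew K key g' g hb, Pr_wl K key g' g (List.pairwise_cons.1 h).2, ih,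
      push_Ew, bdry_push]
    simp only [map_sub]
    abel

lemma bdry_Pr (x : Finset ℕ →₀ K) :
    bdry K (Pr K key g' g x) = push K g x - push K g' x - Pr K key g' g (bdry K x) := by
  have : (bdry K).comp (Pr K key g' g) = push K g - push K g' - (Pr K key g' g).comp (bdry K) := by
    apply lin_ext
    intro s
    rw [epsS_spec K key s]
    simp only [map_smul, LinearMap.comp_apply, LinearMap.sub_apply]
    congr 1
    rw [Pr_wl K key g' g (Rlt_sort key s), bdry_Plist K key g' g (Rlt_sort key s)]
  exact congrArg (fun f => f x) this

end prism

section acyc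
variable (K : Type*) [Field K] {n r : ℕ}

lemma Plist_supp (g' g : ℕ → ℕ) (ok : ℕ → Prop)
    (h1 : ∀ x y, ok x → ok y → le1 n x y → le1 n (g x) (g y))
    (h2 : ∀ x y, ok x → ok y → le1 n x y → le1 n (g' x) (g' y))
    (h3 : ∀ x y, ok x → ok y → le1 n x y → le1 n (g' x) (g y))
    (l : List ℕ) (hl : ∀ x ∈ l, ok x) (hp : l.Pairwise (le1 n)) :
    Plist K g' g l ∈ Finsupp.supported K K {t : Finset ℕ | t.card = l.length + 1 ∧
      (∀ u ∈ t, ∃ x ∈ l, u = g x ∨ u = g' x) ∧ ∀ u ∈ t, ∀ w ∈ t, le1 n w u ∨ le1 n u w} := by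
  induction l with
  | nil => rw [Plist]; exact Submodule.zero_mem _
  | cons v l ih =>
    have ih := ih (fun x hx => hl x (List.mem_cons_of_mem _ hx)) (List.pairwise_cons.1 hp).2
    have hv := (List.pairwise_cons.1 hp).1
    have okv := hl v List.mem_cons_self
    have okl : ∀ x ∈ l, ok x := fun x hx => hl x (List.mem_cons_of_mem _ hx)
    rw [Plist]
    refine Submodule.sub_mem _ ?_ ?_
    · rw [← wl_cons]
      by_cases hn : (g' v :: (v :: l).map g).Nodup
      · obtain ⟨ε, _, e⟩ := wl_nodup K hn
        rw [e]
        refine Submodule.smul_mem _ _ (single_mem_supp K ⟨?_, ?_, ?_⟩)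
        · rw [List.toFinset_card_of_nodup hn]; simp
        · intro u hu
          simp only [List.mem_toFinset, List.mem_cons, List.mem_map] at hu
          rcases hu with rfl | ⟨x, hx, rfl⟩
          · exact ⟨v, List.mem_cons_self, Or.inr rfl⟩
          · exact ⟨x, List.mem_cons.2 hx, Or.inl rfl⟩
        · have hpw : (g' v :: (v :: l).map g).Pairwise (le1 n) := by
            refine List.pairwise_cons.2 ⟨?_, ?_⟩
            · intro u hu
              obtain ⟨x, hx, rfl⟩ := List.mem_map.1 hu
              refine h3 v x okv (hl x hx) ?_
              rcases List.mem_cons.1 hx with rfl | hx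
              · exact le1_refl n _
              · exact hv x hx
            · rw [List.pairwise_map]
              exact hp.imp_of_mem fun ha hb hab => h1 _ _ (hl _ ha) (hl _ hb) hab
          intro u hu w hw
          rw [List.mem_toFinset] at hu hw
          have hsym : Std.Symm (fun u w => le1 n w u ∨ le1 n u w) := ⟨fun _ _ h => h.symm⟩
          exact List.Pairwise.forall_of_forall (R := fun u w => le1 n w u ∨ le1 n u w)
            (fun x hx => Or.inl (le1_refl n x)) (hpw.imp (fun h => Or.inr h)) hu hw
      · rw [wl_dup K hn]; exact Submodule.zero_mem _
    · refine supp_lin K (Ew K (g' v)) _ ?_ ih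
      rintro t ⟨ht1, ht2, ht3⟩
      by_cases hm : g' v ∈ t
      · rw [Ew_mem K hm]; exact Submodule.zero_mem _
      rw [Ew_not_mem K hm]
      have hc : ∀ u ∈ t, le1 n (g' v) u := by
        intro u hu
        obtain ⟨x, hx, rfl | rfl⟩ := ht2 u hu
        · exact h3 v x okv (okl x hx) (hv x hx)
        · exact h2 v x okv (okl x hx) (hv x hx)
      refine Submodule.smul_mem _ _ (single_mem_supp K ⟨?_, ?_, ?_⟩)
      · rw [Finset.card_insert_of_notMem hm, ht1]; rfl
      · intro u hu
        rcases Finset.mem_insert.1 hu with rfl | hu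
        · exact ⟨v, List.mem_cons_self, Or.inr rfl⟩
        · obtain ⟨x, hx, h⟩ := ht2 u hu
          exact ⟨x, List.mem_cons_of_mem _ hx, h⟩
      · intro u hu w hw
        rcases Finset.mem_insert.1 hu with rfl | hu <;> rcases Finset.mem_insert.1 hw with rfl | hw
        · exact Or.inl (le1_refl n _)
        · exact Or.inr (hc w hw)
        · exact Or.inl (hc u hu)
        · exact ht3 u hu w hw

lemma mem_epow {F s : Finset ℕ} : s ∈ edgewise n r F.powerset ↔
    (∀ v ∈ s, Good n r v ∧ spv n v ⊆ F) ∧ ∀ v ∈ s, ∀ w ∈ s, le1 n w v ∨ le1 n v w := by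
  rw [mem_edgewise, Finset.mem_powerset, Finset.biUnion_subset]
  constructor
  · rintro ⟨a, b, c⟩; exact ⟨fun v hv => ⟨a v hv, b v hv⟩, c⟩
  · rintro ⟨a, b⟩; exact ⟨fun v hv => (a v hv).1, fun v hv => (a v hv).2, b⟩

def keyV (n : ℕ) (v : ℕ) : ℕ := ∑ k ∈ Finset.range n, PV n v k

lemma le1_of_Rlt {v w : ℕ} (hv : Good n r v) (hw : Good n r w) (h : le1 n v w ∨ le1 n w v)
    (hR : Rlt (keyV n) v w) : le1 n v w := by
  rcases h with h | h
  · exact h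
  have h1 : keyV n w ≤ keyV n v := Finset.sum_le_sum fun k _ => (h k).1
  have h2 : keyV n w = keyV n v := by rcases hR with h | h <;> omega
  have h3 := (Finset.sum_eq_sum_iff_of_le (fun k _ => (h k).1)).1 h2
  intro k
  rcases le_or_gt n k with hk | hk
  · rw [hv.PV_ge hk, hw.PV_ge hk]; omega
  · rw [h3 k (Finset.mem_range.2 hk)]; omega

lemma exists_gm {ω c : ℕ} (hω : ω < n) (hc : c ≤ r) : ∃ g : ℕ → ℕ, ∀ v, Good n r v →
    Good n r (g v) ∧ ∀ k, PV n (g v) k = if k ≤ ω then min (PV n v k) c else r := by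
  have : ∀ v, ∃ u, Good n r v →
    Good n r u ∧ ∀ k, PV n u k = if k ≤ ω then min (PV n v k) c else r := by
    intro v
    by_cases hv : Good n r v
    · obtain ⟨u, h1, h2⟩ := realize (n := n) (r := r)
        (fun k => if k ≤ ω then min (PV n v k) c else r) (by simp [PV_zero])
        (by
          intro a b hab
          have := PV_mono n v hab
          dsimp only
          split_ifs <;> omega)
        (by intro k hk; rw [if_neg (by omega)])
      exact ⟨u, fun _ => ⟨h1, h2⟩⟩
    · exact ⟨0, fun h => absurd h hv⟩
  choose g hg using this
  exact ⟨g, hg⟩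

lemma acyc_simplex {F : Finset ℕ} (hF : F.Nonempty) (hFn : F ⊆ Finset.range n) :
    Acyc K (edgewise n r F.powerset) := by
  set ω := F.max' hF with hω
  have hωF : ω ∈ F := F.max'_mem hF
  have hωn : ω < n := Finset.mem_range.1 (hFn hωF)
  have hmax : ∀ l ∈ F, l ≤ ω := fun l hl => F.le_max' l hl
  have hex : ∀ c, ∃ g : ℕ → ℕ, c ≤ r → ∀ v, Good n r v →
    Good n r (g v) ∧ ∀ k, PV n (g v) k = if k ≤ ω then min (PV n v k) c else r := by
    intro c
    by_cases hc : c ≤ r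
    · obtain ⟨g, hg⟩ := exists_gm (n := n) hωn hc
      exact ⟨g, fun _ => hg⟩
    · exact ⟨id, fun h => absurd h hc⟩
  choose g hg using hex
  -- support
  have hsp : ∀ c ≤ r, ∀ v, Good n r v ∧ spv n v ⊆ F → Good n r (g c v) ∧ spv n (g c v) ⊆ F := by
    intro c hc v ⟨hv, hvF⟩
    obtain ⟨h1, h2⟩ := hg c hc v hv
    refine ⟨h1, ?_⟩
    intro l hl
    by_contra hlF
    have : l ∉ spv n v := fun h => hlF (hvF h)
    rw [mem_spv] at hl this
    rw [h2, h2] at hl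
    have := PV_mono n v (Nat.le_succ l)
    simp only [Nat.succ_eq_add_one] at this
    by_cases hlω : l = ω
    · subst hlω; exact hlF hωF
    split_ifs at hl <;> omega
  have hle : ∀ c ≤ r, ∀ x y, Good n r x → Good n r y → le1 n x y → le1 n (g c x) (g c y) := by
    intro c hc x y hx hy h k
    rw [(hg c hc x hx).2, (hg c hc y hy).2]
    have := h k
    split_ifs <;> omega
  have hle' : ∀ c, c + 1 ≤ r → ∀ x y, Good n r x → Good n r y → le1 n x y →
      le1 n (g c x) (g (c + 1) y) := by
    intro c hc x y hx hy h k
    rw [(hg c (by omega) x hx).2, (hg (c + 1) hc y hy).2]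
    have := h k
    split_ifs <;> omega
  intro m z hz hbz
  rw [facesSpan_eq] at hz
  have main : ∀ c, c ≤ r → ∃ y ∈ facesSpan K (edgewise n r F.powerset) (m + 1),
      bdry K y = push K (g c) z := by
    intro c
    induction c with
    | zero =>
      intro hc
      obtain ⟨p, hp1, hp2⟩ := realize (n := n) (r := r) (fun k => if k ≤ ω then 0 else r) (by simp)
        (by intro a b hab; dsimp only; split_ifs <;> omega)
        (by intro k hk; rw [if_neg (by omega)])
      have hpF : {p} ∈ edgewise n r F.powerset := by
        rw [mem_epow]
        refine ⟨?_, ?_⟩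
        · intro v hv
          rw [Finset.mem_singleton] at hv; subst hv
          refine ⟨hp1, ?_⟩
          intro l hl
          rw [mem_spv, hp2, hp2] at hl
          have : l = ω := by split_ifs at hl <;> omega
          rw [this]; exact hωF
        · intro v hv w hw
          rw [Finset.mem_singleton] at hv hw; subst hv; subst hw
          exact Or.inl (le1_refl n _)
      have hgp : ∀ v, Good n r v → g 0 v = p := by
        intro v hv
        obtain ⟨h1, h2⟩ := hg 0 hc v hv
        apply h1.inj hp1
        intro k; rw [h2, hp2]; simp
      have hy : push K (g 0) z ∈ Finsupp.supported K K {t : Finset ℕ | t ⊆ {p} ∧ (t.card : ℤ) = m} := by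
        refine supp_lin K (push K (g 0)) _ ?_ hz
        rintro s ⟨hs, hsm⟩
        rcases push_face K (g 0) s with ⟨_, h⟩ | ⟨hi, ε, h⟩
        · rw [h]; exact Submodule.zero_mem _
        · rw [h]
          refine Submodule.smul_mem _ _ (single_mem_supp K ⟨?_, ?_⟩)
          · intro u hu
            obtain ⟨v, hv, rfl⟩ := Finset.mem_image.1 hu
            rw [hgp v ((mem_epow.1 hs).1 v hv).1]; simp
          · rw [Finset.card_image_of_injOn hi, hsm]
      refine ⟨Ew K p (push K (g 0) z), ?_, ?_⟩
      · refine supp_lin K (Ew K p) _ ?_ hy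
        rintro t ⟨ht, htm⟩
        by_cases hpt : p ∈ t
        · rw [Ew_mem K hpt]; exact Submodule.zero_mem _
        · rw [Ew_not_mem K hpt]
          refine Submodule.smul_mem _ _ (single_mem_facesSpan K ?_ ?_)
          · have : insert p t = {p} := by
              rw [Finset.insert_eq, Finset.union_eq_left.2 ht]
            rw [this]; exact hpF
          · rw [Finset.card_insert_of_notMem hpt]; push_cast; rw [htm]
      · rw [bdry_Ew, bdry_push, hbz]; simp
    | succ c ih =>
      intro hc
      obtain ⟨y, hy, hyb⟩ := ih (by omega)
      refine ⟨y + Pr K (keyV n) (g c) (g (c + 1)) z, Submodule.add_mem _ hy ?_, ?_⟩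
      · refine supp_lin K (Pr K (keyV n) (g c) (g (c + 1))) _ ?_ hz
        rintro s ⟨hs, hsm⟩
        rw [mem_epow] at hs
        rw [Pr_single]
        refine Submodule.smul_mem _ _ ?_
        rw [facesSpan_eq]
        have hmem : ∀ x ∈ s.sort (Rle (keyV n)), Good n r x ∧ spv n x ⊆ F :=
          fun x hx => hs.1 x ((Finset.mem_sort _).1 hx)
        have := Plist_supp K (n := n) (g c) (g (c + 1)) (fun x => Good n r x ∧ spv n x ⊆ F)
          (fun x y hx hy h => hle _ hc x y hx.1 hy.1 h)
          (fun x y hx hy h => hle _ (by omega) x y hx.1 hy.1 h)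
          (fun x y hx hy h => hle' _ hc x y hx.1 hy.1 h)
          (s.sort (Rle (keyV n))) hmem
          ((Rlt_sort (keyV n) s).imp_of_mem fun ha hb hab =>
            le1_of_Rlt (hmem _ ha).1 (hmem _ hb).1
              ((hs.2 _ ((Finset.mem_sort _).1 hb) _ ((Finset.mem_sort _).1 ha))) hab)
        refine Finsupp.supported_mono ?_ this
        rintro t ⟨h1, h2, h3⟩
        refine ⟨mem_epow.2 ⟨?_, h3⟩, ?_⟩
        · intro v hv
          obtain ⟨x, hx, rfl | rfl⟩ := h2 v hv
          · exact hsp _ hc x (hmem x hx)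
          · exact hsp _ (by omega) x (hmem x hx)
        · rw [h1, Finset.length_sort]; push_cast; rw [hsm]
      · rw [map_add, hyb, bdry_Pr, hbz]; simp
  obtain ⟨y, hy, hyb⟩ := main r le_rfl
  refine ⟨y, hy, hyb.trans ?_⟩
  refine supp_eq K (push K (g r)) LinearMap.id ?_ hz
  rintro s ⟨hs, _⟩
  rw [push_single, LinearMap.id_apply]
  conv_rhs => rw [← wl_sort, ← List.map_id (s.sort (· ≤ ·))]
  congr 1
  apply List.map_congr_left
  intro v hv
  obtain ⟨hv1, hv2⟩ := (mem_epow.1 hs).1 v ((Finset.mem_sort _).1 hv)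
  obtain ⟨h1, h2⟩ := hg r le_rfl v hv1
  apply h1.inj hv1
  intro k
  rw [h2]
  split_ifs with hk
  · exact min_eq_left (hv1.PV_le k)
  · symm; apply hv1.PV_last
    intro l hl
    have := hmax l (hv2 hl); omega

end acyc
end

noncomputable section
open scoped Classical

section main
variable (K : Type*) [Field K] {n r : ℕ}

lemma facesSpan_lin {Γ : SC} {m : ℤ} (f : (Finset ℕ →₀ K) →ₗ[K] (Finset ℕ →₀ K))
    (N : Submodule K (Finset ℕ →₀ K))
    (h : ∀ s ∈ Γ, (s.card : ℤ) = m → f (Finsupp.single s 1) ∈ N) {x : Finset ℕ →₀ K}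
    (hx : x ∈ facesSpan K Γ m) : f x ∈ N := by
  rw [facesSpan_eq] at hx
  exact supp_lin K f N (fun s hs => h s hs.1 hs.2) hx

lemma facesSpan_eqOn {Γ : SC} {m : ℤ} (f g : (Finset ℕ →₀ K) →ₗ[K] (Finset ℕ →₀ K))
    (h : ∀ s ∈ Γ, f (Finsupp.single s 1) = g (Finsupp.single s 1)) {x : Finset ℕ →₀ K}
    (hx : x ∈ facesSpan K Γ m) : f x = g x := by
  rw [facesSpan_eq] at hx
  exact supp_eq K f g (fun s hs => h s hs.1) hx

def IsSd (n r : ℕ) (Γ : SC) (S : (Finset ℕ →₀ K) →ₗ[K] (Finset ℕ →₀ K)) : Prop :=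
  S (Finsupp.single ∅ 1) = Finsupp.single ∅ 1 ∧ ∀ s ∈ Γ,
    S (Finsupp.single s 1) ∈ facesSpan K (edgewise n r s.powerset) s.card ∧
    bdry K (S (Finsupp.single s 1)) = S (bdry K (Finsupp.single s 1))

lemma exists_sd {Γ : SC} (hΓ : IsComplex Γ) (hn : ∀ s ∈ Γ, s ⊆ Finset.range n) :
    ∃ S, IsSd K n r Γ S := by
  obtain ⟨S, h0, hS⟩ := carrier K Γ hΓ (fun s => edgewise n r s.powerset)
    (fun s t h => edgewise_mono (Finset.powerset_mono.2 h))
    (fun s hs hne => acyc_simplex K hne (hn s hs)) 0 1 0 (Finsupp.single ∅ 1)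
    (by intro s _; simp) (by intro s _; simp)
    (single_mem_facesSpan K (by rw [mem_epow]; simp) (by simp)) (by simp [bdry_empty])
  refine ⟨S, h0, fun s hs => ?_⟩
  obtain ⟨h1, h2⟩ := hS s hs
  refine ⟨by simpa using h1, by simpa using h2⟩

lemma push_label {Γ : SC} (hΓ : IsComplex Γ) {lam : ℕ → ℕ}
    (hl : ∀ v, Good n r v → lam v ∈ spv n v) {m : ℤ} {x : Finset ℕ →₀ K}
    (hx : x ∈ facesSpan K (edgewise n r Γ) m) : push K lam x ∈ facesSpan K Γ m := by
  refine facesSpan_lin K (push K lam) _ ?_ hx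
  intro s hs hm
  rcases push_face K lam s with ⟨_, h⟩ | ⟨hi, ε, h⟩
  · rw [h]; exact Submodule.zero_mem _
  · rw [h]
    obtain ⟨h1, h2, h3⟩ := mem_edgewise.1 hs
    refine Submodule.smul_mem _ _ (single_mem_facesSpan K (hΓ _ h2 _ ?_) ?_)
    · intro u hu
      obtain ⟨v, hv, rfl⟩ := Finset.mem_image.1 hu
      exact Finset.mem_biUnion.2 ⟨v, hv, hl v (h1 v hv)⟩
    · rw [Finset.card_image_of_injOn hi, hm]

lemma bdry_single_ne {s : Finset ℕ} (hs : s.Nonempty) : bdry K (Finsupp.single s 1) ≠ 0 := by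
  obtain ⟨v, hv⟩ := hs
  intro h
  have := bdry_Ew K v (Finsupp.single s 1)
  rw [Ew_mem K hv, h] at this
  have h1 : (Finsupp.single s (1:K)) = 0 := by simpa using this.symm
  exact one_ne_zero (Finsupp.single_eq_zero.1 h1)

lemma push_sd {Γ : SC} (hΓ : IsComplex Γ) {lam : ℕ → ℕ}
    (hl : ∀ v, Good n r v → lam v ∈ spv n v) {S : (Finset ℕ →₀ K) →ₗ[K] (Finset ℕ →₀ K)}
    (hS : IsSd K n r Γ S) (s : Finset ℕ) (hs : s ∈ Γ) :
    push K lam (S (Finsupp.single s 1)) = Finsupp.single s 1 := by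
  induction s using Finset.strongInduction with
  | H s ih =>
    rcases s.eq_empty_or_nonempty with rfl | hne
    · rw [hS.1, push_empty]
    obtain ⟨h1, h2⟩ := hS.2 s hs
    have h3 := push_label K (powerset_complex s) hl h1
    obtain ⟨c, hc⟩ : ∃ c : K, push K lam (S (Finsupp.single s 1)) = c • Finsupp.single s 1 := by
      refine ⟨push K lam (S (Finsupp.single s 1)) s, ?_⟩
      rw [Finsupp.smul_single, smul_eq_mul, mul_one, ← Finsupp.support_subset_singleton]
      intro t ht
      obtain ⟨h4, h5⟩ := (mem_facesSpan K).1 h3 t ht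
      rw [Finset.mem_singleton]
      exact Finset.eq_of_subset_of_card_le (Finset.mem_powerset.1 h4) (by omega)
    have h4 : bdry K (push K lam (S (Finsupp.single s 1))) = bdry K (Finsupp.single s 1) := by
      rw [bdry_push, h2, bdry_single, bdryFace, map_sum, map_sum]
      refine Finset.sum_congr rfl fun v hv => ?_
      rw [map_smul, map_smul, ih _ (Finset.erase_ssubset hv) (hΓ s hs _ (Finset.erase_subset _ _))]
    rw [hc, map_smul] at h4
    have h5 : (c - 1) • bdry K (Finsupp.single s 1) = 0 := by
      rw [sub_smul, h4, one_smul, sub_self]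
    rcases smul_eq_zero.1 h5 with h6 | h6
    · rw [hc, sub_eq_zero.1 h6, one_smul]
    · exact absurd h6 (bdry_single_ne K hne)

lemma sd_mem {Γ : SC} (hΓ : IsComplex Γ) {S : (Finset ℕ →₀ K) →ₗ[K] (Finset ℕ →₀ K)}
    (hS : IsSd K n r Γ S) {m : ℤ} {x : Finset ℕ →₀ K} (hx : x ∈ facesSpan K Γ m) :
    S x ∈ facesSpan K (edgewise n r Γ) m := by
  refine facesSpan_lin K S _ ?_ hx
  intro s hs hm
  rw [← hm]
  refine facesSpan_mono K (edgewise_mono ?_) _ (hS.2 s hs).1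
  intro t ht
  exact hΓ s hs t (Finset.mem_powerset.1 ht)

lemma exists_label (hr : 1 ≤ r) : ∃ lam : ℕ → ℕ, ∀ v, Good n r v → lam v ∈ spv n v := by
  have : ∀ v, ∃ l, Good n r v → l ∈ spv n v := by
    intro v
    by_cases h : Good n r v
    · obtain ⟨l, hl⟩ := h.spv_nonempty hr
      exact ⟨l, fun _ => hl⟩
    · exact ⟨0, fun h' => absurd h' h⟩
  choose f hf using this
  exact ⟨f, hf⟩

lemma redHdim_edgewise (hr : 1 ≤ r) {Γ : SC} (hΓ : IsComplex Γ)
    (hn : ∀ s ∈ Γ, s ⊆ Finset.range n) {m : ℤ}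
    (h : redHdim K Γ m ≠ 0) : redHdim K (edgewise n r Γ) m ≠ 0 := by
  rw [redHdim_ne_zero] at h ⊢
  obtain ⟨z, hz, hz0, hzn⟩ := h
  obtain ⟨S, hS⟩ := exists_sd K (n := n) (r := r) hΓ hn
  obtain ⟨lam, hl⟩ := exists_label (n := n) hr
  refine ⟨S z, sd_mem K hΓ hS hz, ?_, ?_⟩
  · have := facesSpan_eqOn K ((bdry K).comp S) (S.comp (bdry K)) (fun s hs => (hS.2 s hs).2) hz
    simp only [LinearMap.comp_apply] at this
    rw [this, hz0, map_zero]
  · rintro ⟨y, hy, hyz⟩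
    refine hzn ⟨push K lam y, push_label K hΓ hl hy, ?_⟩
    rw [bdry_push, hyz]
    exact facesSpan_eqOn K ((push K lam).comp S) LinearMap.id (fun s hs => push_sd K hΓ hl hS s hs) hz

lemma induced_complex {Δ : SC} (hΔ : IsComplex Δ) (W : Finset ℕ) : IsComplex (inducedSC Δ W) := by
  intro s hs t ht
  rw [inducedSC, Finset.mem_filter] at *
  exact ⟨hΔ s hs.1 t ht, ht.trans hs.2⟩

lemma induced_edgewise {Δ : SC} (W : Finset ℕ) :
    inducedSC (edgewise n r Δ) ((vertexSet (edgewise n r Δ)).filter (fun v => spv n v ⊆ W)) =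
      edgewise n r (inducedSC Δ W) := by
  ext s
  rw [inducedSC, Finset.mem_filter, mem_edgewise (Γ := inducedSC Δ W), inducedSC, Finset.mem_filter,
    Finset.biUnion_subset]
  constructor
  · rintro ⟨h1, h2⟩
    obtain ⟨a, b, c⟩ := mem_edgewise.1 h1
    exact ⟨a, ⟨b, fun v hv => (Finset.mem_filter.1 (h2 hv)).2⟩, c⟩
  · rintro ⟨a, ⟨b, b'⟩, c⟩
    have h1 : s ∈ edgewise n r Δ := mem_edgewise.2 ⟨a, b, c⟩
    exact ⟨h1, fun v hv => Finset.mem_filter.2 ⟨vertex_mem h1 hv, b' v hv⟩⟩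

lemma reg_ge_of_induced (hr : 1 ≤ r) {Δ : SC} (hΔ : IsComplex Δ)
    (hn : ∀ s ∈ Δ, s ⊆ Finset.range n) {W : Finset ℕ} {m : ℕ}
    (h : redHdim K (inducedSC Δ W) (m : ℤ) ≠ 0) : m ≤ regSR K (edgewise n r Δ) := by
  apply le_regSR K (Finset.filter_subset (fun v => spv n v ⊆ W) _)
  rw [induced_edgewise]
  exact redHdim_edgewise K hr (induced_complex hΔ W)
    (fun s hs => hn s (Finset.mem_filter.1 hs).1) h

lemma reg_ge (hr : 1 ≤ r) {Δ : SC} (hΔ : IsComplex Δ)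
    (hn : ∀ s ∈ Δ, s ⊆ Finset.range n) : regSR K Δ ≤ regSR K (edgewise n r Δ) := by
  by_cases h : regSR K Δ = 0
  · omega
  · obtain ⟨W, _, hW⟩ := exists_of_lt_regSR K h
    exact reg_ge_of_induced K hr hΔ hn hW

lemma redHdim_face {Γ : SC} {m : ℤ} (h : redHdim K Γ m ≠ 0) : ∃ s ∈ Γ, (s.card : ℤ) = m := by
  by_contra! hc
  obtain ⟨z, hz, _, hn⟩ := (redHdim_ne_zero K).1 h
  have := facesSpan_zero K hc hz
  subst this
  exact hn ⟨0, Submodule.zero_mem _, by simp⟩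

lemma reg_le (hr : 1 ≤ r) {Δ : SC} {d : ℕ} (hdim : ∀ s ∈ Δ, s.card ≤ d) :
    regSR K (edgewise n r Δ) ≤ d := by
  apply regSR_le
  intro W _ m hm
  obtain ⟨s, hs, hc⟩ := redHdim_face K hm
  have h1 := (Finset.mem_filter.1 hs).1
  have := card_le hr h1
  have := hdim _ (mem_edgewise.1 h1).2.1
  omega

lemma top_zero (hr : 1 ≤ r) {Δ : SC} {d : ℕ} (hΔ : IsComplex Δ)
    (hn : ∀ s ∈ Δ, s ⊆ Finset.range n) (hdim : ∀ s ∈ Δ, s.card ≤ d)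
    (h : redHdim K Δ (d : ℤ) = 0) {z : Finset ℕ →₀ K}
    (hz : z ∈ facesSpan K (edgewise n r Δ) (d : ℤ)) (hbz : bdry K z = 0) : z = 0 := by
  obtain ⟨S, hS⟩ := exists_sd K (n := n) (r := r) hΔ hn
  obtain ⟨lam, hl⟩ := exists_label (n := n) hr
  have hE := edgewise_complex (n := n) (r := r) hΔ
  have hlz : push K lam z = 0 := by
    by_contra hne
    apply (redHdim_ne_zero K (Δ := Δ) (m := d)).2 _ h
    refine ⟨push K lam z, push_label K hΔ hl hz, by rw [bdry_push, hbz, map_zero], ?_⟩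
    rintro ⟨y, hy, hyz⟩
    have : y = 0 := facesSpan_zero K (fun s hs => by have := hdim s hs; omega) hy
    rw [this, map_zero] at hyz
    exact hne hyz.symm
  have hsub : ∀ s ∈ edgewise n r Δ, s ∈ edgewise n r (s.biUnion (spv n)).powerset := by
    intro s hs
    obtain ⟨a, b, c⟩ := mem_edgewise.1 hs
    exact mem_edgewise.2 ⟨a, by simp, c⟩
  have hpow : ∀ F ∈ Δ, F.powerset ⊆ Δ := fun F hF t ht => hΔ F hF t (Finset.mem_powerset.1 ht)
  obtain ⟨D, _, hD⟩ := carrier K (edgewise n r Δ) hE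
    (fun s => edgewise n r (s.biUnion (spv n)).powerset)
    (fun s t h => edgewise_mono
      (Finset.powerset_mono.2 (Finset.biUnion_subset_biUnion_of_subset_left _ h)))
    (by
      intro s hs hne
      obtain ⟨a, b, c⟩ := mem_edgewise.1 hs
      refine acyc_simplex K ?_ (hn _ b)
      obtain ⟨v, hv⟩ := hne
      obtain ⟨l, hl⟩ := (a v hv).spv_nonempty hr
      exact ⟨l, Finset.mem_biUnion.2 ⟨v, hv, hl⟩⟩)
    (LinearMap.id - S.comp (push K lam)) (-1) 1 0
    (by
      intro s hs
      rw [add_sub_cancel_right, LinearMap.sub_apply, LinearMap.id_apply, LinearMap.comp_apply]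
      have h1 := single_mem_facesSpan K (hsub s hs) rfl
      refine Submodule.sub_mem _ h1 ?_
      have hF := (mem_edgewise.1 hs).2.1
      have h2 := push_label K (powerset_complex _) hl h1
      have hS' : IsSd K n r (s.biUnion (spv n)).powerset S :=
        ⟨hS.1, fun t ht => hS.2 t (hpow _ hF ht)⟩
      exact sd_mem K (powerset_complex _) hS' h2)
    (by
      intro s hs
      have h1 := push_label K hΔ hl (single_mem_facesSpan K hs rfl)
      have h2 := facesSpan_eqOn K ((bdry K).comp S) (S.comp (bdry K)) (fun s hs => (hS.2 s hs).2) h1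
      simp only [LinearMap.comp_apply] at h2
      simp only [LinearMap.sub_apply, LinearMap.id_apply, LinearMap.comp_apply, map_sub, h2,
        bdry_push, neg_smul, one_smul]
      abel)
    (Submodule.zero_mem _)
    (by simp [push_empty, hS.1])
  have h1 : D z = 0 := by
    refine facesSpan_zero K (Δ := edgewise n r Δ) (m := (d : ℤ) + 1) ?_ ?_
    · intro s hs
      have := card_le hr hs
      have := hdim _ (mem_edgewise.1 hs).2.1
      omega
    · refine facesSpan_lin K D _ ?_ hz
      intro s hs hm
      rw [← hm]
      exact facesSpan_mono K (edgewise_mono (hpow _ (mem_edgewise.1 hs).2.1)) _ (hD s hs).1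
  have h2 := facesSpan_eqOn K ((bdry K).comp D)
    ((LinearMap.id - S.comp (push K lam)) + (-1 : K) • (D.comp (bdry K)))
    (fun s hs => (hD s hs).2) hz
  simp only [LinearMap.comp_apply, LinearMap.add_apply, LinearMap.sub_apply, LinearMap.id_apply,
    LinearMap.smul_apply, h1, hlz, hbz, map_zero, smul_zero, add_zero, sub_zero] at h2
  exact h2.symm

lemma reg_le_pred (hr : 1 ≤ r) {Δ : SC} {d : ℕ} (hΔ : IsComplex Δ)
    (hn : ∀ s ∈ Δ, s ⊆ Finset.range n) (hdim : ∀ s ∈ Δ, s.card ≤ d)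
    (h : redHdim K Δ (d : ℤ) = 0) : regSR K (edgewise n r Δ) ≤ d - 1 := by
  apply regSR_le
  intro W _ m hm
  obtain ⟨s, hs, hc⟩ := redHdim_face K hm
  have h1 := (Finset.mem_filter.1 hs).1
  have := card_le hr h1
  have := hdim _ (mem_edgewise.1 h1).2.1
  rcases Nat.lt_or_ge m d with hlt | hge
  · omega
  exfalso
  have hmd : m = d := by omega
  subst hmd
  obtain ⟨z, hz, hbz, hnz⟩ := (redHdim_ne_zero K).1 hm
  have := top_zero K hr hΔ hn hdim h (facesSpan_mono K (Finset.filter_subset _ _) _ hz) hbz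
  subst this
  exact hnz ⟨0, Submodule.zero_mem _, by simp⟩

lemma coord_eq {a v : ℕ} (ha : Good n r a) (hv : Good n r v)
    (h : ∀ l, PV n a (l + 1) + PV n v l ≤ PV n v (l + 1) + PV n a l) : a = v := by
  have hm : Monotone (fun k => (PV n v k : ℤ) - PV n a k) :=
    monotone_nat_of_le_succ fun k => by have := h k; omega
  apply ha.inj hv
  intro k
  rcases le_total n k with hk | hk
  · rw [ha.PV_ge hk, hv.PV_ge hk]
  · have h1 := hm (Nat.zero_le k)
    have h2 := hm hk
    simp only [PV_zero, ha.PV_ge le_rfl, hv.PV_ge le_rfl] at h1 h2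
    omega

lemma exists_interior {F : Finset ℕ} (hF : F.Nonempty) (hFn : F ⊆ Finset.range n)
    (hr : F.card ≤ r) : ∃ v, Good n r v ∧ spv n v = F := by
  set ω := F.max' hF with hω
  have hωF : ω ∈ F := F.max'_mem hF
  have hωn : ω < n := Finset.mem_range.1 (hFn hωF)
  have hmax : ∀ l ∈ F, l ≤ ω := fun l hl => F.le_max' l hl
  have hcm : ∀ a b, a ≤ b → (F.filter (fun l => l < a)).card ≤ (F.filter (fun l => l < b)).card := by
    intro a b hab
    apply Finset.card_le_card
    intro l hl
    rw [Finset.mem_filter] at *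
    exact ⟨hl.1, by omega⟩
  have hcr : ∀ a, (F.filter (fun l => l < a)).card ≤ F.card :=
    fun a => Finset.card_le_card (Finset.filter_subset _ _)
  have hcs : ∀ a, (F.filter (fun l => l < a + 1)).card =
      (F.filter (fun l => l < a)).card + if a ∈ F then 1 else 0 := by
    intro a
    split_ifs with h
    · have : F.filter (fun l => l < a + 1) = insert a (F.filter (fun l => l < a)) := by
        ext l; simp only [Finset.mem_filter, Finset.mem_insert]
        constructor
        · rintro ⟨h1, h2⟩
          rcases (by omega : l = a ∨ l < a) with h3 | h3
          · exact Or.inl h3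
          · exact Or.inr ⟨h1, h3⟩
        · rintro (rfl | ⟨h1, h2⟩)
          · exact ⟨h, by omega⟩
          · exact ⟨h1, by omega⟩
      rw [this, Finset.card_insert_of_notMem (by simp)]
    · rw [add_zero]; congr 1
      ext l; simp only [Finset.mem_filter]
      constructor
      · rintro ⟨h1, h2⟩
        refine ⟨h1, ?_⟩
        rcases (by omega : l = a ∨ l < a) with h3 | h3
        · subst h3; exact absurd h1 h
        · exact h3
      · rintro ⟨h1, h2⟩; exact ⟨h1, by omega⟩
  obtain ⟨v, h1, h2⟩ := realize (n := n) (r := r)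
    (fun k => if k ≤ ω then (F.filter (fun l => l < k)).card else r) (by simp)
    (by
      intro a b hab
      have := hcm a b hab
      have := hcr a
      dsimp only; split_ifs <;> omega)
    (by intro k hk; rw [if_neg (by omega)])
  refine ⟨v, h1, ?_⟩
  ext l
  rw [mem_spv, h2, h2]
  have e1 := hcs l
  have e2 := hcr (l + 1)
  by_cases hl : l ∈ F
  · have := hmax l hl
    rw [if_pos hl] at e1
    simp only [hl, iff_true]
    split_ifs <;> omega
  · have : l ≠ ω := fun e => hl (e ▸ hωF)
    rw [if_neg hl] at e1
    simp only [hl, iff_false]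
    split_ifs <;> omega

lemma exists_label' (hr : 1 ≤ r) {v : ℕ} (hv : Good n r v) : ∃ lam : ℕ → ℕ, ∀ a, Good n r a →
    lam a ∈ spv n a ∧ (a ≠ v →
      PV n v (lam a + 1) + PV n a (lam a) < PV n a (lam a + 1) + PV n v (lam a)) := by
  have : ∀ a, ∃ l, Good n r a → l ∈ spv n a ∧ (a ≠ v →
      PV n v (l + 1) + PV n a l < PV n a (l + 1) + PV n v l) := by
    intro a
    by_cases h : Good n r a
    · by_cases hav : a = v
      · obtain ⟨l, hl⟩ := h.spv_nonempty hr
        exact ⟨l, fun _ => ⟨hl, fun h => absurd hav h⟩⟩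
      · by_contra! hc
        apply hav
        apply coord_eq h hv
        intro l
        obtain ⟨_, h2⟩ := hc l
        by_contra h3
        push Not at h3
        have hm := PV_mono n v (Nat.le_succ l)
        simp only [Nat.succ_eq_add_one] at hm
        have := (h2 (mem_spv.2 (by omega))).2
        omega
    · exact ⟨0, fun h' => absurd h' h⟩
  choose f hf using this
  exact ⟨f, hf⟩

lemma reg_ge_interior {Δ : SC} (hΔ : IsComplex Δ)
    (hn : ∀ s ∈ Δ, s ⊆ Finset.range n) {F : Finset ℕ} (hF : F ∈ Δ) {m : ℕ} (hm : F.card = m)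
    (hm1 : 1 ≤ m) (hmr : m ≤ r) : m - 1 ≤ regSR K (edgewise n r Δ) := by
  have hr : 1 ≤ r := hm1.trans hmr
  have hFne : F.Nonempty := Finset.card_pos.1 (by omega)
  obtain ⟨v, hv, hvF⟩ := exists_interior (r := r) hFne (hn F hF) (by omega)
  obtain ⟨lam, hlam⟩ := exists_label' hr hv
  have hl : ∀ v, Good n r v → lam v ∈ spv n v := fun a ha => (hlam a ha).1
  obtain ⟨S, hS⟩ := exists_sd K (n := n) (r := r) hΔ hn
  have hEF := edgewise_complex (n := n) (r := r) (powerset_complex F)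
  obtain ⟨hx1, hx2⟩ := hS.2 F hF
  have hx3 := push_sd K hΔ hl hS F hF
  set x := S (Finsupp.single F 1) with hx
  -- rainbow faces contain v
  have rainbow : ∀ t ∈ edgewise n r F.powerset, t.image lam = F → v ∈ t := by
    intro t ht himg
    obtain ⟨ht1, ht2⟩ := mem_epow.1 ht
    by_contra hvt
    have htne : t.Nonempty := by
      rw [← Finset.image_nonempty (f := lam), himg]; exact hFne
    obtain ⟨y, hy⟩ := htne
    have : v = y := by
      apply coord_eq hv (ht1 y hy).1
      intro l
      by_cases hlF : l ∈ F
      · rw [← himg] at hlF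
        obtain ⟨w, hw, rfl⟩ := Finset.mem_image.1 hlF
        have h1 := (hlam w (ht1 w hw).1).2 (fun e => hvt (e ▸ hw))
        rcases ht2 w hw y hy with h2 | h2
        · have := h2 (lam w); have := h2 (lam w + 1); omega
        · have := h2 (lam w); have := h2 (lam w + 1); omega
      · rw [← hvF, mem_spv] at hlF
        have hm := PV_mono n y (Nat.le_succ l)
        simp only [Nat.succ_eq_add_one] at hm
        omega
    exact hvt (this ▸ hy)
  set z := x.filter (fun t => v ∈ t) with hzdef
  set z' := x.filter (fun t => ¬ v ∈ t) with hz'def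
  have hsum : z + z' = x := Finsupp.filter_add_filter_not x _
  have hz0 : z ≠ 0 := by
    intro hz0
    have hno : ∀ t ∈ x.support, v ∉ t := by
      intro t ht hvt
      have : z t = 0 := by rw [hz0]; rfl
      rw [hzdef, Finsupp.filter_apply_pos (fun t => v ∈ t) x hvt] at this
      exact (Finsupp.mem_support_iff.1 ht) this
    have hxs : x ∈ Finsupp.supported K K (x.support : Set (Finset ℕ)) := by
      rw [Finsupp.mem_supported]
    have : push K lam x ∈ Finsupp.supported K K {t : Finset ℕ | t ≠ F} := by
      refine supp_lin K (push K lam) _ ?_ hxs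
      intro t ht
      rcases push_face K lam t with ⟨_, h⟩ | ⟨_, ε, h⟩
      · rw [h]; exact Submodule.zero_mem _
      · rw [h]
        refine Submodule.smul_mem _ _ (single_mem_supp K ?_)
        intro himg
        exact hno t ht (rainbow t ((mem_facesSpan K).1 hx1 t ht).1 himg)
    rw [hx3, Finsupp.mem_supported] at this
    exact this (by simp : F ∈ _) rfl
  have hzs : ∀ t ∈ z.support, v ∈ t ∧ t ∈ edgewise n r F.powerset ∧ (t.card : ℤ) = m := by
    intro t ht
    rw [hzdef, Finsupp.support_filter, Finset.mem_filter] at ht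
    have := (mem_facesSpan K).1 hx1 t ht.1
    exact ⟨ht.2, this.1, by rw [this.2, hm]⟩
  set b := bdry K z with hb
  have hbv : b ∈ Finsupp.supported K K {t : Finset ℕ | v ∉ t} := by
    have e : b = bdry K x - bdry K z' := by rw [← hsum, map_add]; simp [hb]
    rw [e]
    refine Submodule.sub_mem _ ?_ ?_
    · rw [hx2, bdry_single, bdryFace, map_sum]
      refine Submodule.sum_mem _ fun l hlF => ?_
      rw [map_smul]
      refine Submodule.smul_mem _ _ ?_
      have := (hS.2 (F.erase l) (hΔ F hF _ (Finset.erase_subset _ _))).1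
      rw [facesSpan_eq] at this
      refine Finsupp.supported_mono ?_ this
      rintro t ⟨ht, _⟩ hvt
      have := ((mem_epow.1 ht).1 v hvt).2
      rw [hvF] at this
      exact Finset.notMem_erase l F (this hlF)
    · apply bdry_supp K (A := {t : Finset ℕ | v ∉ t}) (fun s hs t ht hvt => hs (ht hvt))
      rw [Finsupp.mem_supported]
      intro t ht
      rw [hz'def, Finsupp.support_filter, Finset.coe_filter] at ht
      exact ht.2
  have hbA : b ∈ Finsupp.supported K K {t : Finset ℕ | insert v t ∈ edgewise n r F.powerset} := by
    apply bdry_supp K (A := {t : Finset ℕ | insert v t ∈ edgewise n r F.powerset})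
    · intro s hs t ht
      exact hEF _ hs _ (Finset.insert_subset_insert _ ht)
    · rw [Finsupp.mem_supported]
      intro t ht
      obtain ⟨h1, h2, _⟩ := hzs t ht
      simpa [Finset.insert_eq_of_mem h1] using h2
  have hbm : b ∈ facesSpan K (edgewise n r F.powerset) ((m : ℤ) - 1) :=
    bdry_facesSpan K hEF ((mem_facesSpan K).2 fun t ht => (hzs t ht).2)
  have hb0 : b ≠ 0 := by
    intro hb0
    have h1 : Ew K v z = 0 := by
      have : z ∈ Finsupp.supported K K {t : Finset ℕ | v ∈ t} := by
        rw [Finsupp.mem_supported]; exact fun t ht => (hzs t ht).1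
      exact supp_eq K (Ew K v) 0 (fun s hs => Ew_mem K hs) this
    have h2 := bdry_Ew K v z
    rw [h1, ← hb, hb0] at h2
    simp at h2
    exact hz0 h2.symm
  have hsubE : edgewise n r F.powerset ⊆ edgewise n r Δ :=
    edgewise_mono fun t ht => hΔ F hF t (Finset.mem_powerset.1 ht)
  set W := (vertexSet (edgewise n r Δ)).filter
    (fun w => w ≠ v ∧ {v, w} ∈ edgewise n r F.powerset) with hW
  have hL : ∀ t ∈ inducedSC (edgewise n r Δ) W, v ∉ t ∧ insert v t ∈ edgewise n r F.powerset := by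
    intro t ht
    rw [inducedSC, Finset.mem_filter] at ht
    obtain ⟨ht1, ht2⟩ := ht
    have hw : ∀ w ∈ t, w ≠ v ∧ {v, w} ∈ edgewise n r F.powerset :=
      fun w hw => (Finset.mem_filter.1 (ht2 hw)).2
    refine ⟨fun h => (hw v h).1 rfl, ?_⟩
    rw [mem_epow]
    constructor
    · intro u hu
      rcases Finset.mem_insert.1 hu with rfl | hu
      · exact ⟨hv, hvF.le⟩
      · exact (mem_epow.1 (hw u hu).2).1 u (by simp)
    · intro u hu w hw'
      rcases Finset.mem_insert.1 hu with hu1 | hu1 <;>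
        rcases Finset.mem_insert.1 hw' with hw1 | hw1
      · rw [hu1, hw1]; exact Or.inl (le1_refl n _)
      · rw [hu1]; exact (mem_epow.1 (hw w hw1).2).2 _ (by simp) _ (by simp)
      · rw [hw1]; exact (mem_epow.1 (hw u hu1).2).2 _ (by simp) _ (by simp)
      · exact (mem_edgewise.1 ht1).2.2 u hu1 w hw1
  apply le_regSR K (Finset.filter_subset _ _ : W ⊆ _)
  rw [redHdim_ne_zero]
  refine ⟨b, ?_, bdry_bdry K z, ?_⟩
  · rw [mem_facesSpan]
    intro t ht
    obtain ⟨h1, h2⟩ := (mem_facesSpan K).1 hbm t ht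
    have h3 : v ∉ t := (Finsupp.mem_supported K b).1 hbv ht
    have h4 : insert v t ∈ edgewise n r F.powerset := (Finsupp.mem_supported K b).1 hbA ht
    refine ⟨Finset.mem_filter.2 ⟨hsubE h1, ?_⟩, by omega⟩
    intro w hw
    refine Finset.mem_filter.2 ⟨vertex_mem (hsubE h1) hw, fun e => h3 (e ▸ hw), ?_⟩
    apply hEF _ h4
    intro u hu
    rcases Finset.mem_insert.1 hu with rfl | hu
    · simp
    · rw [Finset.mem_singleton] at hu; subst hu; exact Finset.mem_insert_of_mem hw
  · rintro ⟨y, hy, hyb⟩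
    have : y = 0 := by
      refine facesSpan_zero K ?_ hy
      intro t ht hc
      obtain ⟨h1, h2⟩ := hL t ht
      have h3 := card_le hr h2
      rw [Finset.card_insert_of_notMem h1] at h3
      have h4 := Finset.card_le_card (Finset.mem_powerset.1 (mem_edgewise.1 h2).2.1)
      omega
    rw [this, map_zero] at hyb
    exact hb0 hyb.symm

end main
end

/-- The Castelnuovo–Mumford regularity of the edgewise subdivision:
`reg(K[Δ^{⟨r⟩}]) = d-1` if `H̃_{d-1}(Δ;K) = 0` and `r ≥ d`; `reg(K[Δ^{⟨r⟩}]) = d` if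
`H̃_{d-1}(Δ;K) ≠ 0`; and `reg(K[Δ^{⟨r⟩}]) ≥ max(reg(K[Δ]), r-1)` for `1 ≤ r ≤ d-1`. -/
theorem statement_16 (K : Type*) [Field K] (d n : ℕ) (hd : 1 ≤ d) (Δ : SC)
    (hC : IsComplex Δ) (hdim : Δ.sup Finset.card = d)
    (hvert : vertexSet Δ = Finset.range n) :
    (∀ r : ℕ, d ≤ r → redHdim K Δ (d : ℤ) = 0 → regSR K (edgewise n r Δ) = d - 1) ∧
    (∀ r : ℕ, 1 ≤ r → redHdim K Δ (d : ℤ) ≠ 0 → regSR K (edgewise n r Δ) = d) ∧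
    (∀ r : ℕ, 1 ≤ r → r ≤ d - 1 →
      max (regSR K Δ) (r - 1) ≤ regSR K (edgewise n r Δ)) := by

  have hn : ∀ s ∈ Δ, s ⊆ Finset.range n := fun s hs => hvert ▸ vertex_mem hs
  have hcard : ∀ s ∈ Δ, s.card ≤ d := fun s hs => hdim ▸ Finset.le_sup (f := Finset.card) hs
  have hne : Δ.Nonempty := by
    rw [Finset.nonempty_iff_ne_empty]
    rintro rfl
    simp at hdim; omega
  obtain ⟨G, hG, hGd⟩ : ∃ G ∈ Δ, G.card = d := by
    obtain ⟨G, hG, h⟩ := Finset.exists_mem_eq_sup Δ hne Finset.card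
    exact ⟨G, hG, by rw [← h, hdim]⟩
  refine ⟨?_, ?_, ?_⟩
  · intro r hr h0
    exact le_antisymm (reg_le_pred K (hd.trans hr) hC hn hcard h0)
      (reg_ge_interior K hC hn hG hGd hd hr)
  · intro r hr h0
    refine le_antisymm (reg_le K hr hcard) ?_
    apply reg_ge_of_induced K hr hC hn (W := Finset.range n)
    have : inducedSC Δ (Finset.range n) = Δ := Finset.filter_true_of_mem hn
    rw [this]; exact h0
  · intro r hr hrd
    refine max_le (reg_ge K hr hC hn) ?_
    obtain ⟨F, hF, hFc⟩ := Finset.exists_subset_card_eq (s := G) (n := r) (by omega)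
    exact reg_ge_interior K hC hn (hC G hG F hF) hFc hr le_rfl
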